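/- Replica-Symmetric formula for the spiked Wigner model: for every λ > 0, the free energy F_n(λ) converges, as n → ∞, to sup_{q ≥ 0} 𝓕(λ,q). -/

import Mathlib

/-!
Replica-Symmetric formula for the spiked Wigner model:
for every λ > 0, the free energy `F n λ` converges as `n → ∞` to `sup_{q ≥ 0} 𝓕(λ, q)`.
-/

open MeasureTheory ProbabilityTheory Filter Finset Real

noncomputable section

/-- The standard Gaussian measure on `ℝ`. -/
def stdGauss : Measure ℝ := gaussianReal 0 1

/-- The set of pairs `(i, j)` with `i < j`. -/
def pairs (n : ℕ) : Finset (Fin n × Fin n) :=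
  Finset.univ.filter fun p => p.1 < p.2

/-- The Hamiltonian of the spiked Wigner model:
`H_n(x) = Σ_{i<j} √(λ/n) x_i x_j Z_{ij} + (λ/n) X_i X_j x_i x_j − (λ/(2n)) x_i² x_j²`. -/
def hamiltonian (n : ℕ) (lam : ℝ) (X : Fin n → ℝ) (Z : Fin n × Fin n → ℝ)
    (x : Fin n → ℝ) : ℝ :=
  ∑ p ∈ pairs n,
    (Real.sqrt (lam / n) * x p.1 * x p.2 * Z p
      + lam / n * X p.1 * X p.2 * x p.1 * x p.2
      - lam / (2 * n) * (x p.1) ^ 2 * (x p.2) ^ 2)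

/-- The free energy `F_n(λ) = (1/n) E[log ∫ exp(H_n(x)) dP0⊗n(x)]`, where the expectation
is over `X_i` i.i.d. `P0` and `Z_{ij}` i.i.d. standard Gaussian. -/
def freeEnergy (P0 : Measure ℝ) (n : ℕ) (lam : ℝ) : ℝ :=
  (1 / n) * ∫ X, (∫ Z,
      Real.log (∫ x, Real.exp (hamiltonian n lam X Z x)
        ∂(Measure.pi fun _ : Fin n => P0))
    ∂(Measure.pi fun _ : Fin n × Fin n => stdGauss))
    ∂(Measure.pi fun _ : Fin n => P0)

/-- The scalar free energy
`ψ_{P0}(γ) = E[log ∫ exp(√γ Z x + γ x X − (γ/2) x²) dP0(x)]`. -/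
def scalarFE (P0 : Measure ℝ) (γ : ℝ) : ℝ :=
  ∫ x0, (∫ z,
      Real.log (∫ x,
        Real.exp (Real.sqrt γ * z * x + γ * x * x0 - γ / 2 * x ^ 2) ∂P0)
    ∂stdGauss) ∂P0

/-- The Replica-Symmetric potential `𝓕(λ, q) = ψ_{P0}(λ q) − (λ/4) q²`. -/
def RSpot (P0 : Measure ℝ) (lam q : ℝ) : ℝ :=
  scalarFE P0 (lam * q) - lam / 4 * q ^ 2

/-- `sup_{q ≥ 0} 𝓕(λ, q)`. -/
def RSsup (P0 : Measure ℝ) (lam : ℝ) : ℝ :=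
  sSup (RSpot P0 lam '' Set.Ici 0)

instance : IsProbabilityMeasure stdGauss := by
  unfold stdGauss; infer_instance

lemma stdGauss_integrable_exp_mul_abs (c : ℝ) :
    Integrable (fun x : ℝ => Real.exp (c * |x|)) stdGauss :=
  integrable_exp_mul_abs (X := fun x : ℝ => x) (integrable_exp_mul_gaussianReal c)
    (integrable_exp_mul_gaussianReal (-c))

/-- The law of a standard Gaussian vector indexed by `ι`. -/
abbrev stdGaussPi (ι : Type*) [Fintype ι] : Measure (ι → ℝ) :=
  Measure.pi fun _ : ι => stdGauss

lemma stdGaussPi_integrable_exp_mul_sum_abs {ι : Type*} [Fintype ι] (c : ℝ) :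
    Integrable (fun z : ι → ℝ => Real.exp (c * ∑ i, |z i|)) (stdGaussPi ι) := by
  have h : (fun z : ι → ℝ => Real.exp (c * ∑ i, |z i|))
      = fun z => ∏ i, Real.exp (c * |z i|) := by
    funext z
    rw [Finset.mul_sum, Real.exp_sum]
  rw [h]
  exact Integrable.fintype_prod (f := fun _ : ι => fun x : ℝ => Real.exp (c * |x|))
    fun _ => stdGauss_integrable_exp_mul_abs c

lemma stdGaussPi_integrable_of_le {ι : Type*} [Fintype ι] {f : (ι → ℝ) → ℝ}
    (hf : AEStronglyMeasurable f (stdGaussPi ι)) {M c : ℝ}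
    (h : ∀ z, |f z| ≤ M * Real.exp (c * ∑ i, |z i|)) : Integrable f (stdGaussPi ι) :=
  ((stdGaussPi_integrable_exp_mul_sum_abs c).const_mul M).mono' hf (ae_of_all _ h)

lemma hasDerivAt_gaussianPDFReal_zero_one (x : ℝ) :
    HasDerivAt (gaussianPDFReal 0 1) (-x * gaussianPDFReal 0 1 x) x := by
  have h1 : HasDerivAt (fun x : ℝ => -(x - 0) ^ 2 / (2 * ((1 : NNReal) : ℝ))) (-x) x := by
    have := (((hasDerivAt_id x).sub_const 0).pow 2).neg.div_const (2 * ((1 : NNReal) : ℝ))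
    refine this.congr_deriv ?_
    simp
    ring
  have := (h1.exp).const_mul ((√(2 * π * ((1 : NNReal) : ℝ)))⁻¹)
  rw [gaussianPDFReal_def]
  refine this.congr_deriv ?_
  ring

/-- Gaussian integration by parts in one dimension. -/
lemma stdGauss_integral_id_mul {f f' : ℝ → ℝ} (hd : ∀ x, HasDerivAt f (f' x) x)
    (hf' : Continuous f') {M c : ℝ} (hb : ∀ x, |f x| ≤ M * Real.exp (c * |x|))
    (hb' : ∀ x, |f' x| ≤ M * Real.exp (c * |x|)) :
    ∫ x, x * f x ∂stdGauss = ∫ x, f' x ∂stdGauss := by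
  have hfc : Continuous f := continuous_iff_continuousAt.2 fun x => (hd x).continuousAt
  have hM : 0 ≤ M := by
    have := (abs_nonneg _).trans (hb 0)
    simpa using this
  have i1 : Integrable f stdGauss :=
    ((stdGauss_integrable_exp_mul_abs c).const_mul M).mono' hfc.aestronglyMeasurable
      (ae_of_all _ hb)
  have i2 : Integrable f' stdGauss :=
    ((stdGauss_integrable_exp_mul_abs c).const_mul M).mono' hf'.aestronglyMeasurable
      (ae_of_all _ hb')
  have i3 : Integrable (fun x => x * f x) stdGauss := by
    refine ((stdGauss_integrable_exp_mul_abs (1 + c)).const_mul M).mono'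
      (continuous_id.mul hfc).aestronglyMeasurable (ae_of_all _ fun x => ?_)
    have h1 : |x| ≤ Real.exp |x| := by linarith [Real.add_one_le_exp |x|]
    calc ‖x * f x‖ = |x| * |f x| := by rw [Real.norm_eq_abs, abs_mul]
      _ ≤ Real.exp |x| * (M * Real.exp (c * |x|)) :=
          mul_le_mul h1 (hb x) (abs_nonneg _) (Real.exp_pos _).le
      _ = M * Real.exp ((1 + c) * |x|) := by rw [add_mul, Real.exp_add, one_mul]; ring
  have key : ∀ g : ℝ → ℝ, Integrable g stdGauss →
      Integrable (fun x => gaussianPDFReal 0 1 x * g x) := by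
    intro g hg
    have := (integrable_withDensity_iff_integrable_smul'
      (μ := (volume : Measure ℝ)) (measurable_gaussianPDF 0 1)
      (ae_of_all _ fun _ => gaussianPDF_lt_top) (g := g)).1 (by
        rwa [stdGauss, gaussianReal_of_var_ne_zero _ one_ne_zero] at hg)
    simpa [toReal_gaussianPDF] using this
  have hz := integral_eq_zero_of_hasDerivAt_of_integrable
    (f := fun x => gaussianPDFReal 0 1 x * f x)
    (f' := fun x => gaussianPDFReal 0 1 x * (f' x - x * f x))
    (fun x => ((hasDerivAt_gaussianPDFReal_zero_one x).mul (hd x)).congr_deriv (by ring))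
    (key _ (i2.sub i3)) (key _ i1)
  have hz' : ∫ x, (f' x - x * f x) ∂stdGauss = 0 := by
    rw [stdGauss, integral_gaussianReal_eq_integral_smul one_ne_zero]
    simpa using hz
  rw [integral_sub i2 i3] at hz'
  linarith

lemma measurePreserving_update {ι : Type*} [Fintype ι] [DecidableEq ι] {E : Type*}
    [MeasurableSpace E] (μ : Measure E) [IsProbabilityMeasure μ] (i : ι) :
    MeasurePreserving (fun p : (ι → E) × E => Function.update p.1 i p.2)
      ((Measure.pi fun _ : ι => μ).prod μ) (Measure.pi fun _ : ι => μ) := by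
  have hm : Measurable (fun p : (ι → E) × E => Function.update p.1 i p.2) := by
    refine measurable_pi_lambda _ fun j => ?_
    by_cases h : j = i
    · subst h; simpa using measurable_snd
    · simp only [Function.update_of_ne h]
      exact (measurable_pi_apply j).comp measurable_fst
  refine ⟨hm, (Measure.pi_eq fun s hs => ?_).symm⟩
  rw [Measure.map_apply hm (MeasurableSet.univ_pi hs)]
  have : (fun p : (ι → E) × E => Function.update p.1 i p.2) ⁻¹' (Set.univ.pi s)
      = (Set.univ.pi (Function.update s i Set.univ)) ×ˢ s i := by
    ext ⟨z, g⟩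
    simp only [Set.mem_preimage, Set.mem_pi, Set.mem_univ, true_imp_iff, Set.mem_prod]
    constructor
    · intro h
      refine ⟨fun j => ?_, by simpa using h i⟩
      by_cases hj : j = i
      · subst hj; simp
      · simpa [hj] using h j
    · rintro ⟨h1, h2⟩ j
      by_cases hj : j = i
      · subst hj; simpa using h2
      · simpa [hj] using h1 j
  rw [this, Measure.prod_prod, Measure.pi_pi, ← Finset.mul_prod_erase _ _ (Finset.mem_univ i),
    ← Finset.mul_prod_erase _ (fun j => μ (s j)) (Finset.mem_univ i)]
  simp only [Function.update_self, measure_univ, one_mul]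
  rw [mul_comm]
  congr 1
  refine Finset.prod_congr rfl fun j hj => ?_
  rw [Function.update_of_ne (Finset.ne_of_mem_erase hj)]

lemma sum_abs_update_le {ι : Type*} [Fintype ι] [DecidableEq ι] (z : ι → ℝ) (i : ι) (g : ℝ) :
    ∑ j, |Function.update z i g j| ≤ (∑ j, |z j|) + |g| := by
  calc ∑ j, |Function.update z i g j| ≤ ∑ j, (|z j| + if j = i then |g| else 0) := by
        refine Finset.sum_le_sum fun j _ => ?_
        by_cases hj : j = i
        · subst hj; simp
        · simp [hj]
    _ = _ := by rw [Finset.sum_add_distrib]; simp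

/-- Gaussian integration by parts along a coordinate of a standard Gaussian vector. -/
lemma stdGaussPi_integral_coord_mul {ι : Type*} [Fintype ι] [DecidableEq ι] (i : ι)
    {f f' : (ι → ℝ) → ℝ}
    (hd : ∀ z g, HasDerivAt (fun t => f (Function.update z i t)) (f' (Function.update z i g)) g)
    (hfc : Continuous f) (hf' : Continuous f') {M c : ℝ} (hc : 0 ≤ c)
    (hb : ∀ z, |f z| ≤ M * Real.exp (c * ∑ j, |z j|))
    (hb' : ∀ z, |f' z| ≤ M * Real.exp (c * ∑ j, |z j|)) :
    Integrable (fun z => z i * f z) (stdGaussPi ι) ∧ Integrable f' (stdGaussPi ι) ∧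
      ∫ z, z i * f z ∂stdGaussPi ι = ∫ z, f' z ∂stdGaussPi ι := by
  have hM : 0 ≤ M := by
    have := (abs_nonneg _).trans (hb 0)
    simpa using this
  have i2 : Integrable f' (stdGaussPi ι) :=
    stdGaussPi_integrable_of_le hf'.aestronglyMeasurable hb'
  have i3 : Integrable (fun z => z i * f z) (stdGaussPi ι) := by
    refine stdGaussPi_integrable_of_le (M := M) (c := 1 + c)
      ((continuous_apply i).mul hfc).aestronglyMeasurable fun z => ?_
    have h0 : |z i| ≤ ∑ j, |z j| :=
      Finset.single_le_sum (f := fun j => |z j|) (fun j _ => abs_nonneg _) (Finset.mem_univ i)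
    have h1 : |z i| ≤ Real.exp (∑ j, |z j|) := by
      linarith [Real.add_one_le_exp (∑ j, |z j|)]
    calc |z i * f z| = |z i| * |f z| := abs_mul _ _
      _ ≤ Real.exp (∑ j, |z j|) * (M * Real.exp (c * ∑ j, |z j|)) :=
          mul_le_mul h1 (hb z) (abs_nonneg _) (Real.exp_pos _).le
      _ = M * Real.exp ((1 + c) * ∑ j, |z j|) := by rw [add_mul, Real.exp_add, one_mul]; ring
  have mp := measurePreserving_update stdGauss i
  have e : ∀ h : (ι → ℝ) → ℝ, Integrable h (stdGaussPi ι) →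
      ∫ z, h z ∂stdGaussPi ι
        = ∫ z, ∫ g, h (Function.update z i g) ∂stdGauss ∂stdGaussPi ι := by
    intro h hh
    have hh' : AEStronglyMeasurable h
        (Measure.map (fun p : (ι → ℝ) × ℝ => Function.update p.1 i p.2)
          ((stdGaussPi ι).prod stdGauss)) := by
      rw [mp.map_eq]; exact hh.aestronglyMeasurable
    have := integral_map mp.measurable.aemeasurable hh'
    rw [mp.map_eq] at this
    rw [this, integral_prod]
    exact (mp.integrable_comp hh.aestronglyMeasurable).2 hh
  refine ⟨i3, i2, ?_⟩
  rw [e _ i3, e _ i2]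
  refine integral_congr_ae (ae_of_all _ fun z => ?_)
  simp only [Function.update_self]
  have hcu : Continuous fun t => Function.update z i t :=
    continuous_const.update i continuous_id
  have hbd : ∀ g : ℝ, M * Real.exp (c * ∑ j, |Function.update z i g j|)
      ≤ (M * Real.exp (c * ∑ j, |z j|)) * Real.exp (c * |g|) := by
    intro g
    rw [mul_assoc, ← Real.exp_add, ← mul_add]
    gcongr
    exact sum_abs_update_le z i g
  exact stdGauss_integral_id_mul (hd z) (hf'.comp hcu)
    (fun g => (hb _).trans (hbd g)) (fun g => (hb' _).trans (hbd g))

lemma stdGauss_map_add_const (a : ℝ) :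
    stdGauss.map (fun x => x + a)
      = stdGauss.withDensity fun x => ENNReal.ofReal (Real.exp (a * x - a ^ 2 / 2)) := by
  rw [stdGauss, gaussianReal_map_add_const, gaussianReal_of_var_ne_zero _ one_ne_zero,
    gaussianReal_of_var_ne_zero _ one_ne_zero, ← withDensity_mul _ (measurable_gaussianPDF _ _)
      (by fun_prop)]
  congr 1
  funext x
  rw [Pi.mul_apply, gaussianPDF_def, gaussianPDF_def,
    ← ENNReal.ofReal_mul (gaussianPDFReal_nonneg _ _ _), gaussianPDFReal_def, gaussianPDFReal_def]
  dsimp only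
  rw [mul_assoc _ (Real.exp _), ← Real.exp_add]
  congr 3
  simp
  ring

lemma stdGauss_integrable_exp_mul_sub (a b : ℝ) :
    Integrable (fun x : ℝ => Real.exp (a * x - b)) stdGauss := by
  have : (fun x : ℝ => Real.exp (a * x - b)) = fun x => Real.exp (a * x) * Real.exp (-b) := by
    funext x; rw [← Real.exp_add, sub_eq_add_neg]
  rw [this]
  exact (integrable_exp_mul_gaussianReal a).mul_const _

/-- Cameron–Martin formula: a translate of the standard Gaussian law has the Gaussian
exponential density. -/
lemma stdGaussPi_map_add_const {ι : Type*} [Fintype ι] (a : ι → ℝ) :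
    (stdGaussPi ι).map (fun z => z + a)
      = (stdGaussPi ι).withDensity fun z =>
        ENNReal.ofReal (Real.exp (∑ i, (a i * z i - a i ^ 2 / 2))) := by
  have h1 : (stdGaussPi ι).map (fun z => z + a)
      = Measure.pi fun i => stdGauss.map (fun x => x + a i) :=
    Measure.pi_map_pi (μ := fun _ : ι => stdGauss) (f := fun i x => x + a i)
      fun i => by fun_prop
  have : ∀ i, IsProbabilityMeasure (stdGauss.map (fun x => x + a i)) :=
    fun i => Measure.isProbabilityMeasure_map (by fun_prop)
  rw [h1]
  refine Measure.pi_eq fun s hs => ?_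
  have hbox : MeasurableSet (Set.univ.pi s) := MeasurableSet.univ_pi hs
  let d : ι → ℝ → ℝ := fun i => (s i).indicator fun x => Real.exp (a i * x - a i ^ 2 / 2)
  have hd0 : ∀ i x, 0 ≤ d i x := fun i x => Set.indicator_nonneg (fun _ _ => (Real.exp_pos _).le) x
  have hdi : ∀ i, Integrable (d i) stdGauss :=
    fun i => (stdGauss_integrable_exp_mul_sub _ _).indicator (hs i)
  have h2 : ∀ i, (stdGauss.map (fun x => x + a i)) (s i)
      = ENNReal.ofReal (∫ x, d i x ∂stdGauss) := by
    intro i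
    rw [stdGauss_map_add_const, withDensity_apply _ (hs i),
      ofReal_integral_eq_lintegral_ofReal (hdi i) (ae_of_all _ (hd0 i)),
      ← lintegral_indicator (hs i)]
    refine lintegral_congr fun x => ?_
    by_cases hx : x ∈ s i <;> simp [d, hx]
  simp_rw [h2]
  rw [← ENNReal.ofReal_prod_of_nonneg fun i _ => integral_nonneg (hd0 i),
    ← integral_fintype_prod_eq_prod (𝕜 := ℝ) (fun i => d i),
    ofReal_integral_eq_lintegral_ofReal (Integrable.fintype_prod_dep hdi)
      (ae_of_all _ fun x => Finset.prod_nonneg fun i _ => hd0 i _),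
    withDensity_apply _ hbox, ← lintegral_indicator hbox]
  refine lintegral_congr fun z => ?_
  by_cases hz : z ∈ Set.univ.pi s
  · rw [Set.indicator_of_mem hz, Real.exp_sum]
    congr 1
    refine Finset.prod_congr rfl fun i _ => ?_
    simp [d, hz i (Set.mem_univ i)]
  · rw [Set.indicator_of_notMem hz]
    obtain ⟨i, hi⟩ : ∃ i, z i ∉ s i := by
      by_contra! h
      exact hz fun i _ => h i
    rw [Finset.prod_eq_zero (Finset.mem_univ i) (by simp [d, hi])]
    simp

lemma stdGaussPi_integral_comp_add {ι : Type*} [Fintype ι] (a : ι → ℝ) {f : (ι → ℝ) → ℝ}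
    (hf : Measurable f) :
    ∫ z, f (z + a) ∂stdGaussPi ι
      = ∫ z, Real.exp (∑ i, (a i * z i - a i ^ 2 / 2)) * f z ∂stdGaussPi ι := by
  rw [← integral_map (φ := fun z => z + a) (f := f) (by fun_prop) hf.aestronglyMeasurable,
    stdGaussPi_map_add_const, integral_withDensity_eq_integral_toReal_smul (by fun_prop)
      (ae_of_all _ fun _ => ENNReal.ofReal_lt_top)]
  simp [ENNReal.toReal_ofReal (Real.exp_pos _).le]

lemma stdGaussPi_integral_exp {ι : Type*} [Fintype ι] (a : ι → ℝ) :
    ∫ z, Real.exp (∑ i, (a i * z i - a i ^ 2 / 2)) ∂stdGaussPi ι = 1 := by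
  have := stdGaussPi_integral_comp_add a (f := fun _ => 1) measurable_const
  simpa using this.symm

lemma measurePreserving_comp_inl {ι κ E : Type*} [Fintype ι] [Fintype κ] [MeasurableSpace E]
    (μ : Measure E) [IsProbabilityMeasure μ] :
    MeasurePreserving (fun (z : ι ⊕ κ → E) i => z (Sum.inl i))
      (Measure.pi fun _ : ι ⊕ κ => μ) (Measure.pi fun _ : ι => μ) :=
  measurePreserving_fst.comp (measurePreserving_sumPiEquivProdPi fun _ : ι ⊕ κ => μ)

lemma measurePreserving_comp_inr {ι κ E : Type*} [Fintype ι] [Fintype κ] [MeasurableSpace E]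
    (μ : Measure E) [IsProbabilityMeasure μ] :
    MeasurePreserving (fun (z : ι ⊕ κ → E) i => z (Sum.inr i))
      (Measure.pi fun _ : ι ⊕ κ => μ) (Measure.pi fun _ : κ => μ) :=
  measurePreserving_snd.comp (measurePreserving_sumPiEquivProdPi fun _ : ι ⊕ κ => μ)

lemma measurePreserving_neg_stdGauss :
    MeasurePreserving (fun x : ℝ => -x) stdGauss stdGauss :=
  ⟨measurable_neg, by rw [stdGauss, gaussianReal_map_neg, neg_zero]⟩

section Interpolation

variable {Ω ι : Type*} [Fintype ι]

/-- The energy of the configuration `x` in the Gaussian channel with signal map `A` and extra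
deterministic energy `W`, at the observation `z`. -/
def channelEnergy (A : Ω → ι → ℝ) (W : Ω → ℝ) (x : Ω) (z : ι → ℝ) : ℝ :=
  ∑ i, (A x i * z i - A x i ^ 2 / 2) + W x

/-- The partition function of the Gaussian channel with prior weights `w`. -/
def channelZ [Fintype Ω] (w : Ω → ℝ) (A : Ω → ι → ℝ) (W : Ω → ℝ) (z : ι → ℝ) : ℝ :=
  ∑ x, w x * Real.exp (channelEnergy A W x z)

/-- A twice continuously differentiable function on `(0, ∞)` with polynomial growth at both
ends. -/
structure TameC2 (Φ Φ' Φ'' : ℝ → ℝ) : Prop where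
  deriv1 : ∀ u, 0 < u → HasDerivAt Φ (Φ' u) u
  deriv2 : ∀ u, 0 < u → HasDerivAt Φ' (Φ'' u) u
  cont : ContinuousOn Φ'' (Set.Ioi 0)
  bound0 : ∀ u, 0 < u → |Φ u| ≤ Real.exp (2 * |Real.log u|)
  bound1 : ∀ u, 0 < u → |Φ' u| ≤ Real.exp (2 * |Real.log u|)
  bound2 : ∀ u, 0 < u → |Φ'' u| ≤ Real.exp (2 * |Real.log u|)

lemma continuous_channelEnergy (A : Ω → ι → ℝ) (W : Ω → ℝ) (x : Ω) :
    Continuous (channelEnergy A W x) := by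
  unfold channelEnergy; fun_prop

lemma continuous_channelZ [Fintype Ω] (w : Ω → ℝ) (A : Ω → ι → ℝ) (W : Ω → ℝ) :
    Continuous (channelZ w A W) := by
  unfold channelZ
  have := continuous_channelEnergy A W
  fun_prop

lemma abs_channelEnergy_le {A : Ω → ι → ℝ} {W : Ω → ℝ} {K : ℝ} (hA : ∀ x i, |A x i| ≤ K)
    (hW : ∀ x, |W x| ≤ K) (x : Ω) (z : ι → ℝ) :
    |channelEnergy A W x z| ≤ (Fintype.card ι * K ^ 2 + K) * (1 + ∑ i, |z i|) := by
  have hK : 0 ≤ K := (abs_nonneg _).trans (hW x)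
  have hN : 0 ≤ ∑ i, |z i| := Finset.sum_nonneg fun i _ => abs_nonneg _
  have h1 : |∑ i, (A x i * z i - A x i ^ 2 / 2)| ≤ ∑ i, (K * |z i| + K ^ 2) := by
    refine (Finset.abs_sum_le_sum_abs _ _).trans (Finset.sum_le_sum fun i _ => ?_)
    have h2 : |A x i * z i| ≤ K * |z i| := by
      rw [abs_mul]; exact mul_le_mul_of_nonneg_right (hA x i) (abs_nonneg _)
    have h3 : A x i ^ 2 ≤ K ^ 2 := sq_le_sq' (by linarith [neg_abs_le (A x i), hA x i])
      ((le_abs_self _).trans (hA x i))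
    rw [abs_le] at h2 ⊢
    constructor <;> nlinarith [sq_nonneg (A x i)]
  rw [Finset.sum_add_distrib, ← Finset.mul_sum] at h1
  simp only [Finset.sum_const, Finset.card_univ, nsmul_eq_mul] at h1
  unfold channelEnergy
  refine (abs_add_le _ _).trans ?_
  have h4 : 0 ≤ (Fintype.card ι : ℝ) * K ^ 2 := by positivity
  nlinarith [hW x, mul_nonneg h4 hN]

lemma exp_le_of_abs_le {t b : ℝ} (h : |t| ≤ b) : Real.exp t ≤ Real.exp b :=
  Real.exp_le_exp.2 ((le_abs_self _).trans h)

variable [Fintype Ω] {w : Ω → ℝ}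

lemma weighted_sum_le (hw : ∀ x, 0 ≤ w x) (hw1 : ∑ x, w x = 1)
    {f : Ω → ℝ} {b : ℝ} (h : ∀ x, f x ≤ b) : ∑ x, w x * f x ≤ b :=
  calc ∑ x, w x * f x ≤ ∑ x, w x * b :=
        Finset.sum_le_sum fun x _ => mul_le_mul_of_nonneg_left (h x) (hw x)
    _ = b := by rw [← Finset.sum_mul, hw1, one_mul]

lemma abs_weighted_sum_le (hw : ∀ x, 0 ≤ w x) (hw1 : ∑ x, w x = 1)
    {f : Ω → ℝ} {b : ℝ} (h : ∀ x, |f x| ≤ b) : |∑ x, w x * f x| ≤ b :=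
  abs_le.2 ⟨by
    have := weighted_sum_le hw hw1 (f := fun x => - f x) (b := b)
      fun x => (neg_le_abs _).trans (h x)
    simp only [mul_neg, Finset.sum_neg_distrib] at this
    linarith, weighted_sum_le hw hw1 fun x => (le_abs_self _).trans (h x)⟩

lemma channelZ_bounds (hw : ∀ x, 0 ≤ w x) (hw1 : ∑ x, w x = 1)
    {A : Ω → ι → ℝ} {W : Ω → ℝ} {z : ι → ℝ} {b : ℝ}
    (h : ∀ x, |channelEnergy A W x z| ≤ b) :
    0 < channelZ w A W z ∧ channelZ w A W z ≤ Real.exp b ∧ |Real.log (channelZ w A W z)| ≤ b := by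
  have h1 : Real.exp (-b) ≤ channelZ w A W z := by
    have := weighted_sum_le hw hw1 (f := fun x => - Real.exp (channelEnergy A W x z))
      (b := - Real.exp (-b)) fun x => neg_le_neg (Real.exp_le_exp.2 (abs_le.1 (h x)).1)
    simp only [mul_neg, Finset.sum_neg_distrib] at this
    unfold channelZ
    linarith
  have h2 : channelZ w A W z ≤ Real.exp b := weighted_sum_le hw hw1 fun x => exp_le_of_abs_le (h x)
  have h0 : 0 < channelZ w A W z := (Real.exp_pos _).trans_le h1
  refine ⟨h0, h2, abs_le.2 ⟨?_, ?_⟩⟩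
  · exact (Real.le_log_iff_exp_le h0).2 h1
  · exact (Real.log_le_iff_le_exp h0).2 h2

lemma channelZ_pos (hw : ∀ x, 0 ≤ w x) (hw1 : ∑ x, w x = 1)
    (A : Ω → ι → ℝ) (W : Ω → ℝ) (z : ι → ℝ) : 0 < channelZ w A W z := by
  have := channelZ_bounds hw hw1 (A := A) (W := W) (z := z)
    (b := ∑ x, |channelEnergy A W x z|)
    fun x => Finset.single_le_sum (f := fun x => |channelEnergy A W x z|)
      (fun _ _ => abs_nonneg _) (Finset.mem_univ x)
  exact this.1

end Interpolation

section Interpolation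

variable {Ω ι : Type*} [Fintype ι]

lemma hasDerivAt_channelEnergy_coord [DecidableEq ι] (A : Ω → ι → ℝ) (W : Ω → ℝ) (x : Ω)
    (i : ι) (z : ι → ℝ) (g : ℝ) :
    HasDerivAt (fun t => channelEnergy A W x (Function.update z i t)) (A x i) g := by
  have h : ∀ t, channelEnergy A W x (Function.update z i t)
      = A x i * t + channelEnergy A W x (Function.update z i 0) := by
    intro t
    unfold channelEnergy
    rw [← Finset.add_sum_erase _ _ (Finset.mem_univ i),
      ← Finset.add_sum_erase _ (fun j => A x j * Function.update z i 0 j - A x j ^ 2 / 2)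
        (Finset.mem_univ i)]
    have : ∑ j ∈ Finset.univ.erase i, (A x j * Function.update z i t j - A x j ^ 2 / 2)
        = ∑ j ∈ Finset.univ.erase i, (A x j * Function.update z i 0 j - A x j ^ 2 / 2) := by
      refine Finset.sum_congr rfl fun j hj => ?_
      rw [Function.update_of_ne (Finset.ne_of_mem_erase hj),
        Function.update_of_ne (Finset.ne_of_mem_erase hj)]
    rw [this]
    simp only [Function.update_self]
    ring
  rw [funext h]
  exact (((hasDerivAt_id g).const_mul (A x i)).add_const _).congr_deriv (mul_one _)

lemma hasDerivAt_channelEnergy {A A' : ℝ → Ω → ι → ℝ} {W W' : ℝ → Ω → ℝ}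
    (hA : ∀ θ x i, HasDerivAt (fun θ => A θ x i) (A' θ x i) θ)
    (hW : ∀ θ x, HasDerivAt (fun θ => W θ x) (W' θ x) θ) (θ : ℝ) (x : Ω) (z : ι → ℝ) :
    HasDerivAt (fun θ => channelEnergy (A θ) (W θ) x z)
      (∑ i, (A' θ x i * z i - A θ x i * A' θ x i) + W' θ x) θ := by
  unfold channelEnergy
  refine HasDerivAt.add (HasDerivAt.fun_sum fun i _ => ?_) (hW θ x)
  refine (((hA θ x i).mul_const (z i)).sub (((hA θ x i).pow 2).div_const 2)).congr_deriv ?_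
  simp; ring

variable [Fintype Ω] {w : Ω → ℝ}

/-- Gaussian integration by parts for one term of a Gibbs average. -/
lemma integral_coord_mul_gibbs [DecidableEq ι] (hw : ∀ x, 0 ≤ w x) (hw1 : ∑ x, w x = 1)
    {A : Ω → ι → ℝ} {W : Ω → ℝ} {K : ℝ} (hA : ∀ x i, |A x i| ≤ K) (hW : ∀ x, |W x| ≤ K)
    {Φ Φ' Φ'' : ℝ → ℝ} (hΦ : TameC2 Φ Φ' Φ'') (x : Ω) (i : ι) :
    Integrable (fun z => z i * (Φ' (channelZ w A W z) * Real.exp (channelEnergy A W x z)))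
      (stdGaussPi ι) ∧
    Integrable (fun z => Φ'' (channelZ w A W z)
            * (∑ y, w y * (Real.exp (channelEnergy A W y z) * A y i))
            * Real.exp (channelEnergy A W x z)
          + Φ' (channelZ w A W z) * (Real.exp (channelEnergy A W x z) * A x i))
      (stdGaussPi ι) ∧
    ∫ z, z i * (Φ' (channelZ w A W z) * Real.exp (channelEnergy A W x z)) ∂stdGaussPi ι
      = ∫ z, (Φ'' (channelZ w A W z)
            * (∑ y, w y * (Real.exp (channelEnergy A W y z) * A y i))
            * Real.exp (channelEnergy A W x z)
          + Φ' (channelZ w A W z) * (Real.exp (channelEnergy A W x z) * A x i))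
        ∂stdGaussPi ι := by
  have hK : 0 ≤ K := (abs_nonneg _).trans (hW x)
  set c : ℝ := Fintype.card ι * K ^ 2 + K with hc
  have hc0 : 0 ≤ c := by positivity
  have hcZ := continuous_channelZ w A W
  have hcE := continuous_channelEnergy A W
  have hpos : ∀ z, channelZ w A W z ∈ Set.Ioi (0 : ℝ) := fun z => channelZ_pos hw hw1 A W z
  have hc1 : Continuous fun z => Φ' (channelZ w A W z) := by
    refine continuous_iff_continuousAt.2 fun z => ?_
    exact ((hΦ.deriv2 _ (hpos z)).continuousAt).comp (hcZ.continuousAt)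
  have hc2 : Continuous fun z => Φ'' (channelZ w A W z) :=
    hΦ.cont.comp_continuous hcZ hpos
  have bnd := fun z => channelZ_bounds hw hw1 (fun x => abs_channelEnergy_le hA hW x z)
  rw [← hc] at bnd
  have bE : ∀ x z, Real.exp (channelEnergy A W x z) ≤ Real.exp (c * (1 + ∑ i, |z i|)) :=
    fun x z => exp_le_of_abs_le (abs_channelEnergy_le hA hW x z)
  have b1 : ∀ z, |Φ' (channelZ w A W z)| ≤ Real.exp (c * (1 + ∑ i, |z i|)) ^ 2 := by
    intro z
    refine (hΦ.bound1 _ (hpos z)).trans ?_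
    rw [← Real.exp_nat_mul]
    exact Real.exp_le_exp.2 (mul_le_mul_of_nonneg_left (bnd z).2.2 (by norm_num))
  have b2 : ∀ z, |Φ'' (channelZ w A W z)| ≤ Real.exp (c * (1 + ∑ i, |z i|)) ^ 2 := by
    intro z
    refine (hΦ.bound2 _ (hpos z)).trans ?_
    rw [← Real.exp_nat_mul]
    exact Real.exp_le_exp.2 (mul_le_mul_of_nonneg_left (bnd z).2.2 (by norm_num))
  have hE1 : ∀ z : ι → ℝ, 1 ≤ Real.exp (c * (1 + ∑ i, |z i|)) := fun z =>
    Real.one_le_exp (mul_nonneg hc0 (add_nonneg zero_le_one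
      (Finset.sum_nonneg fun i _ => abs_nonneg _)))
  have hE4 : ∀ z : ι → ℝ, Real.exp (c * (1 + ∑ i, |z i|)) ^ 4
      = Real.exp (4 * c) * Real.exp (4 * c * ∑ i, |z i|) := by
    intro z
    rw [← Real.exp_nat_mul, ← Real.exp_add]
    congr 1; push_cast; ring
  have hcG : Continuous fun z => ∑ y, w y * (Real.exp (channelEnergy A W y z) * A y i) := by
    fun_prop
  refine stdGaussPi_integral_coord_mul i (M := (1 + 2 * K) * Real.exp (4 * c)) (c := 4 * c)
    ?_ ?_ ?_ (by positivity) ?_ ?_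
  · intro z g
    have hH := fun y => (hasDerivAt_channelEnergy_coord A W y i z g).exp
    have hZ : HasDerivAt (fun t => channelZ w A W (Function.update z i t))
        (∑ y, w y * (Real.exp (channelEnergy A W y (Function.update z i g)) * A y i)) g := by
      unfold channelZ
      exact HasDerivAt.fun_sum fun y _ => (hH y).const_mul _
    have := ((hΦ.deriv2 _ (hpos _)).comp g hZ).mul (hH x)
    exact this
  · exact hc1.mul (hcE x).rexp
  · exact ((hc2.mul hcG).mul (hcE x).rexp).add (hc1.mul ((hcE x).rexp.mul continuous_const))
  · intro z
    rw [mul_assoc, ← hE4]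
    rw [abs_mul, Real.abs_exp]
    set E := Real.exp (c * (1 + ∑ i, |z i|))
    calc _ ≤ E ^ 2 * E := mul_le_mul (b1 z) (bE x z) (Real.exp_pos _).le (by positivity)
      _ ≤ E ^ 2 * E * E := le_mul_of_one_le_right (by positivity) (hE1 z)
      _ = 1 * E ^ 4 := by ring
      _ ≤ _ := by gcongr; linarith
  · intro z
    rw [mul_assoc (1 + 2 * K), ← hE4]
    have hbE := fun y => bE y z
    have hb1 := b1 z
    have hb2 := b2 z
    have hE1 := hE1 z
    set E := Real.exp (c * (1 + ∑ i, |z i|))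
    have hG : |∑ y, w y * (Real.exp (channelEnergy A W y z) * A y i)| ≤ E * K := by
      refine abs_weighted_sum_le hw hw1 fun y => ?_
      rw [abs_mul, Real.abs_exp]
      exact mul_le_mul (hbE y) (hA y i) (abs_nonneg _) (by positivity)
    refine (abs_add_le _ _).trans ?_
    have t1 : |Φ'' (channelZ w A W z) * (∑ y, w y * (Real.exp (channelEnergy A W y z) * A y i))
        * Real.exp (channelEnergy A W x z)| ≤ E ^ 2 * (E * K) * E := by
      rw [abs_mul, abs_mul, Real.abs_exp]
      gcongr
      exact hbE x
    have t2 : |Φ' (channelZ w A W z) * (Real.exp (channelEnergy A W x z) * A x i)|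
        ≤ E ^ 2 * (E * K) := by
      rw [abs_mul, abs_mul, Real.abs_exp]
      gcongr
      · exact hbE x
      · exact hA x i
    have t3 : E ^ 2 * (E * K) ≤ E ^ 2 * (E * K) * E :=
      le_mul_of_one_le_right (by positivity) hE1
    have t4 : (0 : ℝ) ≤ E ^ 4 := by positivity
    nlinarith

end Interpolation

section Interpolation

variable {Ω ι : Type*} [Fintype ι] [Fintype Ω] {w : Ω → ℝ}

lemma hasDerivAt_comp_channelZ (hw : ∀ x, 0 ≤ w x) (hw1 : ∑ x, w x = 1)
    {A A' : ℝ → Ω → ι → ℝ} {W W' : ℝ → Ω → ℝ}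
    (hdA : ∀ θ x i, HasDerivAt (fun θ => A θ x i) (A' θ x i) θ)
    (hdW : ∀ θ x, HasDerivAt (fun θ => W θ x) (W' θ x) θ)
    {Φ Φ' Φ'' : ℝ → ℝ} (hΦ : TameC2 Φ Φ' Φ'') (θ : ℝ) (z : ι → ℝ) :
    HasDerivAt (fun θ => Φ (channelZ w (A θ) (W θ) z))
      (Φ' (channelZ w (A θ) (W θ) z) * ∑ x, w x * (Real.exp (channelEnergy (A θ) (W θ) x z)
        * (∑ i, (A' θ x i * z i - A θ x i * A' θ x i) + W' θ x))) θ := by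
  have hZ : HasDerivAt (fun θ => channelZ w (A θ) (W θ) z)
      (∑ x, w x * (Real.exp (channelEnergy (A θ) (W θ) x z)
        * (∑ i, (A' θ x i * z i - A θ x i * A' θ x i) + W' θ x))) θ := by
    unfold channelZ
    exact HasDerivAt.fun_sum fun x _ =>
      ((hasDerivAt_channelEnergy hdA hdW θ x z).exp).const_mul _
  exact (hΦ.deriv1 _ (channelZ_pos hw hw1 _ _ z)).comp θ hZ

/-- Derivative of the expected entropy along a path of Gaussian channels. -/
lemma hasDerivAt_integral_channelZ (hw : ∀ x, 0 ≤ w x) (hw1 : ∑ x, w x = 1)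
    {A A' : ℝ → Ω → ι → ℝ} {W W' : ℝ → Ω → ℝ} {K : ℝ}
    (hdA : ∀ θ x i, HasDerivAt (fun θ => A θ x i) (A' θ x i) θ)
    (hdW : ∀ θ x, HasDerivAt (fun θ => W θ x) (W' θ x) θ)
    (hK : 0 ≤ K) (hA : ∀ θ x i, |A θ x i| ≤ K) (hA' : ∀ θ x i, |A' θ x i| ≤ K)
    (hW : ∀ θ x, |W θ x| ≤ K) (hW' : ∀ θ x, |W' θ x| ≤ K)
    {Φ Φ' Φ'' : ℝ → ℝ} (hΦ : TameC2 Φ Φ' Φ'') (θ : ℝ) :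
    Integrable (fun z => Φ' (channelZ w (A θ) (W θ) z)
          * (∑ x, w x * (Real.exp (channelEnergy (A θ) (W θ) x z) * W' θ x))
        + Φ'' (channelZ w (A θ) (W θ) z)
          * ∑ x, w x * (Real.exp (channelEnergy (A θ) (W θ) x z)
            * ∑ y, w y * (Real.exp (channelEnergy (A θ) (W θ) y z)
              * ∑ i, A' θ x i * A θ y i))) (stdGaussPi ι) ∧
    HasDerivAt (fun θ => ∫ z, Φ (channelZ w (A θ) (W θ) z) ∂stdGaussPi ι)
      (∫ z, (Φ' (channelZ w (A θ) (W θ) z)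
          * (∑ x, w x * (Real.exp (channelEnergy (A θ) (W θ) x z) * W' θ x))
        + Φ'' (channelZ w (A θ) (W θ) z)
          * ∑ x, w x * (Real.exp (channelEnergy (A θ) (W θ) x z)
            * ∑ y, w y * (Real.exp (channelEnergy (A θ) (W θ) y z)
              * ∑ i, A' θ x i * A θ y i))) ∂stdGaussPi ι) θ := by
  classical
  set c : ℝ := Fintype.card ι * K ^ 2 + K with hc
  have hc0 : 0 ≤ c := by positivity
  have hpos : ∀ θ z, channelZ w (A θ) (W θ) z ∈ Set.Ioi (0 : ℝ) :=
    fun θ z => channelZ_pos hw hw1 _ _ z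
  have bnd := fun θ z => channelZ_bounds hw hw1
    (fun x => abs_channelEnergy_le (hA θ) (hW θ) x z)
  rw [← hc] at bnd
  have bE : ∀ θ x z, Real.exp (channelEnergy (A θ) (W θ) x z)
      ≤ Real.exp (c * (1 + ∑ i, |z i|)) :=
    fun θ x z => exp_le_of_abs_le (abs_channelEnergy_le (hA θ) (hW θ) x z)
  have hbΦ : ∀ (Ψ : ℝ → ℝ), (∀ u, 0 < u → |Ψ u| ≤ Real.exp (2 * |Real.log u|)) → ∀ θ z,
      |Ψ (channelZ w (A θ) (W θ) z)| ≤ Real.exp (c * (1 + ∑ i, |z i|)) ^ 2 := by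
    intro Ψ hΨ θ z
    refine (hΨ _ (hpos θ z)).trans ?_
    rw [← Real.exp_nat_mul]
    exact Real.exp_le_exp.2 (mul_le_mul_of_nonneg_left (bnd θ z).2.2 (by norm_num))
  have hEk : ∀ (k : ℕ) (z : ι → ℝ), Real.exp (c * (1 + ∑ i, |z i|)) ^ k
      = Real.exp (k * c) * Real.exp (k * c * ∑ i, |z i|) := by
    intro k z
    rw [← Real.exp_nat_mul, ← Real.exp_add]
    congr 1; ring
  have hcΦ0 : ∀ θ, Continuous fun z => Φ (channelZ w (A θ) (W θ) z) := by
    refine fun θ => continuous_iff_continuousAt.2 fun z => ?_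
    exact ((hΦ.deriv1 _ (hpos θ z)).continuousAt).comp
      (continuous_channelZ w (A θ) (W θ)).continuousAt
  have hcΦ1 : Continuous fun z => Φ' (channelZ w (A θ) (W θ) z) := by
    refine continuous_iff_continuousAt.2 fun z => ?_
    exact ((hΦ.deriv2 _ (hpos θ z)).continuousAt).comp
      (continuous_channelZ w (A θ) (W θ)).continuousAt
  have hcE := continuous_channelEnergy (A θ) (W θ)
  set D : (ι → ℝ) → ℝ := fun z => Φ' (channelZ w (A θ) (W θ) z)
    * ∑ x, w x * (Real.exp (channelEnergy (A θ) (W θ) x z)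
        * (∑ i, (A' θ x i * z i - A θ x i * A' θ x i) + W' θ x)) with hD
  have hmain : Integrable D (stdGaussPi ι) ∧
      HasDerivAt (fun θ => ∫ z, Φ (channelZ w (A θ) (W θ) z) ∂stdGaussPi ι)
        (∫ z, D z ∂stdGaussPi ι) θ := by
    refine hasDerivAt_integral_of_dominated_loc_of_deriv_le
      (F' := fun θ z => Φ' (channelZ w (A θ) (W θ) z)
        * ∑ x, w x * (Real.exp (channelEnergy (A θ) (W θ) x z)
          * (∑ i, (A' θ x i * z i - A θ x i * A' θ x i) + W' θ x)))
      (s := Set.univ) (bound := fun z => Real.exp (c * (1 + ∑ i, |z i|)) ^ 4)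
      Filter.univ_mem (Eventually.of_forall fun θ => (hcΦ0 θ).aestronglyMeasurable) ?_ ?_ ?_ ?_ ?_
    · refine stdGaussPi_integrable_of_le (hcΦ0 θ).aestronglyMeasurable
        (M := Real.exp ((2 : ℕ) * c)) (c := (2 : ℕ) * c) fun z => ?_
      rw [← hEk]
      exact hbΦ Φ hΦ.bound0 θ z
    · refine Continuous.aestronglyMeasurable (hcΦ1.mul ?_)
      fun_prop
    · refine ae_of_all _ fun z θ _ => ?_
      have hb1 := hbΦ Φ' hΦ.bound1 θ z
      have hbE := fun x => bE θ x z
      set N := ∑ i, |z i| with hN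
      have hN0 : 0 ≤ N := Finset.sum_nonneg fun i _ => abs_nonneg _
      have hcE : c * (1 + N) ≤ Real.exp (c * (1 + N)) := by
        linarith [Real.add_one_le_exp (c * (1 + N))]
      set E := Real.exp (c * (1 + N)) with hE
      have hE0 : 0 < E := Real.exp_pos _
      have h1 : ∀ x, |∑ i, (A' θ x i * z i - A θ x i * A' θ x i) + W' θ x| ≤ E := by
        intro x
        have : |∑ i, (A' θ x i * z i - A θ x i * A' θ x i)| ≤ ∑ i, (K * |z i| + K ^ 2) := by
          refine (Finset.abs_sum_le_sum_abs _ _).trans (Finset.sum_le_sum fun i _ => ?_)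
          refine (abs_sub _ _).trans (add_le_add ?_ ?_)
          · rw [abs_mul]; exact mul_le_mul_of_nonneg_right (hA' θ x i) (abs_nonneg _)
          · rw [abs_mul, sq]; exact mul_le_mul (hA θ x i) (hA' θ x i) (abs_nonneg _) hK
        rw [Finset.sum_add_distrib, ← Finset.mul_sum] at this
        simp only [Finset.sum_const, Finset.card_univ, nsmul_eq_mul] at this
        refine (abs_add_le _ _).trans (le_trans ?_ hcE)
        have h4 : 0 ≤ (Fintype.card ι : ℝ) * K ^ 2 := by positivity
        nlinarith [hW' θ x, mul_nonneg h4 hN0]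
      rw [Real.norm_eq_abs, abs_mul]
      have h2 : |∑ x, w x * (Real.exp (channelEnergy (A θ) (W θ) x z)
          * (∑ i, (A' θ x i * z i - A θ x i * A' θ x i) + W' θ x))| ≤ E * E := by
        refine abs_weighted_sum_le hw hw1 fun x => ?_
        rw [abs_mul, Real.abs_exp]
        exact mul_le_mul (hbE x) (h1 x) (abs_nonneg _) hE0.le
      calc _ ≤ E ^ 2 * (E * E) := mul_le_mul hb1 h2 (abs_nonneg _) (by positivity)
        _ = E ^ 4 := by ring
    · simp_rw [hEk]
      exact (stdGaussPi_integrable_exp_mul_sum_abs _).const_mul _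
    · exact ae_of_all _ fun z θ _ => hasDerivAt_comp_channelZ hw hw1 hdA hdW hΦ θ z
  have ibp := fun x i => integral_coord_mul_gibbs hw hw1 (hA θ) (hW θ) hΦ x i
  set T₁ : Ω → ι → (ι → ℝ) → ℝ := fun x i z => z i * (Φ' (channelZ w (A θ) (W θ) z)
    * Real.exp (channelEnergy (A θ) (W θ) x z)) with hT₁
  set T₂ : Ω → ι → (ι → ℝ) → ℝ := fun x i z => Φ'' (channelZ w (A θ) (W θ) z)
            * (∑ y, w y * (Real.exp (channelEnergy (A θ) (W θ) y z) * A θ y i))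
            * Real.exp (channelEnergy (A θ) (W θ) x z)
          + Φ' (channelZ w (A θ) (W θ) z) * (Real.exp (channelEnergy (A θ) (W θ) x z) * A θ x i)
    with hT₂
  have hI₁ : Integrable (fun z => ∑ x, ∑ i, w x * A' θ x i * T₁ x i z) (stdGaussPi ι) :=
    integrable_finsetSum _ fun x _ => integrable_finsetSum _ fun i _ => (ibp x i).1.const_mul _
  have hI₂ : Integrable (fun z => ∑ x, ∑ i, w x * A' θ x i * T₂ x i z) (stdGaussPi ι) :=
    integrable_finsetSum _ fun x _ => integrable_finsetSum _ fun i _ => (ibp x i).2.1.const_mul _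
  have hII : ∫ z, ∑ x, ∑ i, w x * A' θ x i * T₁ x i z ∂stdGaussPi ι
      = ∫ z, ∑ x, ∑ i, w x * A' θ x i * T₂ x i z ∂stdGaussPi ι := by
    rw [integral_finsetSum _ fun x _ => integrable_finsetSum _ fun i _ =>
        (ibp x i).1.const_mul _,
      integral_finsetSum _ fun x _ => integrable_finsetSum _ fun i _ =>
        (ibp x i).2.1.const_mul _]
    refine Finset.sum_congr rfl fun x _ => ?_
    rw [integral_finsetSum _ fun i _ => (ibp x i).1.const_mul _,
      integral_finsetSum _ fun i _ => (ibp x i).2.1.const_mul _]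
    refine Finset.sum_congr rfl fun i _ => ?_
    rw [integral_const_mul, integral_const_mul, (ibp x i).2.2]
  have hfun : (fun z => Φ' (channelZ w (A θ) (W θ) z)
          * (∑ x, w x * (Real.exp (channelEnergy (A θ) (W θ) x z) * W' θ x))
        + Φ'' (channelZ w (A θ) (W θ) z)
          * ∑ x, w x * (Real.exp (channelEnergy (A θ) (W θ) x z)
            * ∑ y, w y * (Real.exp (channelEnergy (A θ) (W θ) y z)
              * ∑ i, A' θ x i * A θ y i)))
      = fun z => D z - ∑ x, ∑ i, w x * A' θ x i * T₁ x i z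
        + ∑ x, ∑ i, w x * A' θ x i * T₂ x i z := by
    funext z
    have e1 : ∀ x, ∑ y, w y * (Real.exp (channelEnergy (A θ) (W θ) y z)
        * ∑ i, A' θ x i * A θ y i)
        = ∑ i, A' θ x i * ∑ y, w y * (Real.exp (channelEnergy (A θ) (W θ) y z) * A θ y i) := by
      intro x
      simp only [Finset.mul_sum]
      rw [Finset.sum_comm]
      exact Finset.sum_congr rfl fun i _ => Finset.sum_congr rfl fun y _ => by ring
    obtain ⟨G, hG⟩ : ∃ G : ι → ℝ, ∀ i,
        (∑ y, w y * (Real.exp (channelEnergy (A θ) (W θ) y z) * A θ y i)) = G i :=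
      ⟨_, fun _ => rfl⟩
    simp only [hD, hT₁, hT₂, e1, hG]
    simp only [Finset.mul_sum _ _ (Φ' _), Finset.mul_sum _ _ (Φ'' _)]
    rw [← Finset.sum_add_distrib, ← Finset.sum_sub_distrib, ← Finset.sum_add_distrib]
    refine Finset.sum_congr rfl fun x _ => ?_
    generalize Φ' (channelZ w (A θ) (W θ) z) = p
    generalize Φ'' (channelZ w (A θ) (W θ) z) = q
    generalize Real.exp (channelEnergy (A θ) (W θ) x z) = e
    have s1 : ∑ i, w x * A' θ x i * (z i * (p * e)) = w x * p * e * ∑ i, A' θ x i * z i := by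
      rw [Finset.mul_sum]
      exact Finset.sum_congr rfl fun i _ => by ring
    have s2 : ∑ i, w x * A' θ x i * (q * G i * e + p * (e * A θ x i))
        = w x * q * e * (∑ i, A' θ x i * G i) + w x * p * e * ∑ i, A θ x i * A' θ x i := by
      rw [Finset.mul_sum, Finset.mul_sum, ← Finset.sum_add_distrib]
      exact Finset.sum_congr rfl fun i _ => by ring
    rw [s1, s2, Finset.sum_sub_distrib]
    ring
  rw [hfun]
  refine ⟨(hmain.1.sub hI₁).add hI₂, ?_⟩
  rw [integral_add (f := fun z => D z - ∑ x, ∑ i, w x * A' θ x i * T₁ x i z)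
    (hmain.1.sub hI₁) hI₂, integral_sub hmain.1 hI₁, hII, sub_add_cancel]
  exact hmain.2

end Interpolation

section Rotation

variable {Ω ι κ : Type*} [Fintype ι] [Fintype κ] [Fintype Ω] {w : Ω → ℝ}

lemma TameC2.continuous_comp_channelZ {Φ Φ' Φ'' : ℝ → ℝ} (hΦ : TameC2 Φ Φ' Φ'')
    (hw : ∀ x, 0 ≤ w x) (hw1 : ∑ x, w x = 1) (A : Ω → ι → ℝ) (W : Ω → ℝ) :
    Continuous fun z => Φ (channelZ w A W z) :=
  continuous_iff_continuousAt.2 fun z =>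
    ((hΦ.deriv1 _ (channelZ_pos hw hw1 A W z)).continuousAt).comp
      (continuous_channelZ w A W).continuousAt

lemma exists_bound_of_fintype {α : Type*} [Fintype α] (f : α → ℝ) :
    ∃ K, 0 ≤ K ∧ ∀ x, |f x| ≤ K :=
  ⟨∑ x, |f x|, Finset.sum_nonneg fun _ _ => abs_nonneg _, fun x =>
    Finset.single_le_sum (f := fun x => |f x|) (fun _ _ => abs_nonneg _) (Finset.mem_univ x)⟩

lemma integral_comp_inl {f : (ι → ℝ) → ℝ} (hf : Continuous f) :
    ∫ z : ι ⊕ κ → ℝ, f (fun i => z (Sum.inl i)) ∂stdGaussPi (ι ⊕ κ) = ∫ z, f z ∂stdGaussPi ι := by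
  have h := measurePreserving_comp_inl (ι := ι) (κ := κ) stdGauss
  rw [stdGaussPi, stdGaussPi, ← h.map_eq, integral_map h.measurable.aemeasurable
    hf.aestronglyMeasurable]

lemma integral_comp_inr {f : (κ → ℝ) → ℝ} (hf : Continuous f) :
    ∫ z : ι ⊕ κ → ℝ, f (fun i => z (Sum.inr i)) ∂stdGaussPi (ι ⊕ κ) = ∫ z, f z ∂stdGaussPi κ := by
  have h := measurePreserving_comp_inr (ι := ι) (κ := κ) stdGauss
  rw [stdGaussPi, stdGaussPi, ← h.map_eq, integral_map h.measurable.aemeasurable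
    hf.aestronglyMeasurable]

/-- The signal rotated from `b` (at angle `0`) to `a` (at angle `π / 2`). -/
def rotSignal (a : Ω → ι → ℝ) (b : Ω → κ → ℝ) (θ : ℝ) (x : Ω) : ι ⊕ κ → ℝ :=
  Sum.elim (fun i => Real.sin θ * a x i) (fun j => Real.cos θ * b x j)

/-- The deterministic energy interpolating from `V` (at angle `0`) to `U` (at angle `π / 2`). -/
def rotEnergy (U V : Ω → ℝ) (θ : ℝ) (x : Ω) : ℝ :=
  Real.sin θ ^ 2 * U x + Real.cos θ ^ 2 * V x

/-- Comparison of two Gaussian channels through the rotation path between them. -/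
lemma integral_channelZ_le_of_rot (hw : ∀ x, 0 ≤ w x) (hw1 : ∑ x, w x = 1)
    (a : Ω → ι → ℝ) (b : Ω → κ → ℝ) (U V : Ω → ℝ)
    {Φ Φ' Φ'' : ℝ → ℝ} (hΦ : TameC2 Φ Φ' Φ'') (D : ℝ)
    (hD : ∀ θ : ℝ,
      Integrable (fun z => Φ' (channelZ w (rotSignal a b θ) (rotEnergy U V θ) z)
          * (∑ x, w x * (Real.exp (channelEnergy (rotSignal a b θ) (rotEnergy U V θ) x z)
            * (2 * (U x - V x))))
        + Φ'' (channelZ w (rotSignal a b θ) (rotEnergy U V θ) z)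
          * ∑ x, w x * (Real.exp (channelEnergy (rotSignal a b θ) (rotEnergy U V θ) x z)
            * ∑ y, w y * (Real.exp (channelEnergy (rotSignal a b θ) (rotEnergy U V θ) y z)
              * (∑ i, a x i * a y i - ∑ j, b x j * b y j)))) (stdGaussPi (ι ⊕ κ)) →
      ∫ z, (Φ' (channelZ w (rotSignal a b θ) (rotEnergy U V θ) z)
          * (∑ x, w x * (Real.exp (channelEnergy (rotSignal a b θ) (rotEnergy U V θ) x z)
            * (2 * (U x - V x))))
        + Φ'' (channelZ w (rotSignal a b θ) (rotEnergy U V θ) z)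
          * ∑ x, w x * (Real.exp (channelEnergy (rotSignal a b θ) (rotEnergy U V θ) x z)
            * ∑ y, w y * (Real.exp (channelEnergy (rotSignal a b θ) (rotEnergy U V θ) y z)
              * (∑ i, a x i * a y i - ∑ j, b x j * b y j)))) ∂(stdGaussPi (ι ⊕ κ)) ≤ 2 * D) :
    ∫ z, Φ (channelZ w a U z) ∂stdGaussPi ι ≤ ∫ z, Φ (channelZ w b V z) ∂stdGaussPi κ + D := by
  obtain ⟨Ka, hKa, ha⟩ := exists_bound_of_fintype fun p : Ω × ι => a p.1 p.2
  obtain ⟨Kb, hKb, hb⟩ := exists_bound_of_fintype fun p : Ω × κ => b p.1 p.2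
  obtain ⟨KU, hKU, hU⟩ := exists_bound_of_fintype U
  obtain ⟨KV, hKV, hV⟩ := exists_bound_of_fintype V
  set K := Ka + Kb + 2 * (KU + KV) with hK
  have hK0 : 0 ≤ K := by positivity
  have hs : ∀ θ, |Real.sin θ| ≤ 1 := Real.abs_sin_le_one
  have hc : ∀ θ, |Real.cos θ| ≤ 1 := Real.abs_cos_le_one
  have hmul : ∀ {s t B : ℝ}, |s| ≤ 1 → |t| ≤ B → |s * t| ≤ B := by
    intro s t B h1 h2
    rw [abs_mul]
    nlinarith [abs_nonneg s, abs_nonneg t]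
  set A' : ℝ → Ω → ι ⊕ κ → ℝ := fun θ x =>
    Sum.elim (fun i => Real.cos θ * a x i) (fun j => -Real.sin θ * b x j) with hA'
  set W' : ℝ → Ω → ℝ := fun θ x =>
    2 * Real.sin θ * Real.cos θ * (U x - V x) with hW'
  have main := hasDerivAt_integral_channelZ hw hw1 (A := rotSignal a b) (A' := A')
    (W := rotEnergy U V) (W' := W') (K := K)
    (by
      rintro θ x (i | j)
      · exact (Real.hasDerivAt_sin θ).mul_const _
      · exact (Real.hasDerivAt_cos θ).mul_const _)
    (by
      intro θ x
      have := (((Real.hasDerivAt_sin θ).pow 2).mul_const (U x)).add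
        (((Real.hasDerivAt_cos θ).pow 2).mul_const (V x))
      refine this.congr_deriv ?_
      push_cast
      ring)
    hK0
    (by
      rintro θ x (i | j)
      · exact (hmul (hs θ) (ha (x, i))).trans (by linarith)
      · exact (hmul (hc θ) (hb (x, j))).trans (by linarith))
    (by
      rintro θ x (i | j)
      · exact (hmul (hc θ) (ha (x, i))).trans (by linarith)
      · exact (hmul (by rw [abs_neg]; exact hs θ) (hb (x, j))).trans (by linarith))
    (by
      intro θ x
      have h1 : |Real.sin θ ^ 2| ≤ 1 := by rw [abs_pow]; exact pow_le_one₀ (abs_nonneg _) (hs θ)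
      have h2 : |Real.cos θ ^ 2| ≤ 1 := by rw [abs_pow]; exact pow_le_one₀ (abs_nonneg _) (hc θ)
      exact (abs_add_le _ _).trans
        ((add_le_add (hmul h1 (hU x)) (hmul h2 (hV x))).trans (by linarith)))
    (by
      intro θ x
      have h1 : |Real.sin θ * Real.cos θ| ≤ 1 := hmul (hs θ) (hc θ)
      have h2 : |2 * (U x - V x)| ≤ 2 * (KU + KV) := by
        rw [abs_mul, abs_two]
        exact mul_le_mul_of_nonneg_left
          ((abs_sub _ _).trans (add_le_add (hU x) (hV x))) (by norm_num)
      have := hmul h1 h2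
      simp only [hW']
      refine le_trans (le_of_eq ?_) (this.trans (by linarith))
      congr 1; ring)
    hΦ
  set φ : ℝ → ℝ := fun θ =>
    ∫ z, Φ (channelZ w (rotSignal a b θ) (rotEnergy U V θ) z) ∂stdGaussPi (ι ⊕ κ) with hφ
  have hanti : AntitoneOn (φ - fun θ => D * (Real.sin ^ 2) θ) (Set.Icc 0 (π / 2)) := by
    have hdφ := fun θ => ((main θ).2.sub (((Real.hasDerivAt_sin θ).pow 2).const_mul D))
    refine antitoneOn_of_deriv_nonpos (convex_Icc _ _)
      (fun θ _ => (hdφ θ).continuousAt.continuousWithinAt)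
      (fun θ _ => (hdφ θ).differentiableAt.differentiableWithinAt) ?_
    intro θ hθ
    rw [interior_Icc] at hθ
    have hsp : 0 < Real.sin θ := Real.sin_pos_of_pos_of_lt_pi hθ.1 (by linarith [hθ.2, Real.pi_pos])
    have hcp : 0 < Real.cos θ := Real.cos_pos_of_mem_Ioo ⟨by linarith [hθ.1, Real.pi_pos], hθ.2⟩
    have hsc : 0 < Real.sin θ * Real.cos θ := mul_pos hsp hcp
    rw [(hdφ θ).deriv]
    have hcorr : ∀ x y, ∑ i, A' θ x i * rotSignal a b θ y i
        = Real.sin θ * Real.cos θ * (∑ i, a x i * a y i - ∑ j, b x j * b y j) := by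
      intro x y
      simp only [hA', rotSignal, Fintype.sum_sum_type, Sum.elim_inl, Sum.elim_inr]
      rw [mul_sub, Finset.mul_sum, Finset.mul_sum, sub_eq_add_neg, ← Finset.sum_neg_distrib]
      congr 1 <;> exact Finset.sum_congr rfl fun i _ => by ring
    have hθint := (main θ).1
    have hfun : ∀ z, Φ' (channelZ w (rotSignal a b θ) (rotEnergy U V θ) z)
          * (∑ x, w x * (Real.exp (channelEnergy (rotSignal a b θ) (rotEnergy U V θ) x z)
            * W' θ x))
        + Φ'' (channelZ w (rotSignal a b θ) (rotEnergy U V θ) z)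
          * ∑ x, w x * (Real.exp (channelEnergy (rotSignal a b θ) (rotEnergy U V θ) x z)
            * ∑ y, w y * (Real.exp (channelEnergy (rotSignal a b θ) (rotEnergy U V θ) y z)
              * ∑ i, A' θ x i * rotSignal a b θ y i))
      = (Real.sin θ * Real.cos θ) *
        (Φ' (channelZ w (rotSignal a b θ) (rotEnergy U V θ) z)
          * (∑ x, w x * (Real.exp (channelEnergy (rotSignal a b θ) (rotEnergy U V θ) x z)
            * (2 * (U x - V x))))
        + Φ'' (channelZ w (rotSignal a b θ) (rotEnergy U V θ) z)
          * ∑ x, w x * (Real.exp (channelEnergy (rotSignal a b θ) (rotEnergy U V θ) x z)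
            * ∑ y, w y * (Real.exp (channelEnergy (rotSignal a b θ) (rotEnergy U V θ) y z)
              * (∑ i, a x i * a y i - ∑ j, b x j * b y j)))) := by
      intro z
      have e1 : ∀ x, ∑ y, w y * (Real.exp (channelEnergy (rotSignal a b θ) (rotEnergy U V θ) y z)
              * ∑ i, A' θ x i * rotSignal a b θ y i)
          = Real.sin θ * Real.cos θ *
            ∑ y, w y * (Real.exp (channelEnergy (rotSignal a b θ) (rotEnergy U V θ) y z)
              * (∑ i, a x i * a y i - ∑ j, b x j * b y j)) := by
        intro x
        rw [Finset.mul_sum]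
        exact Finset.sum_congr rfl fun y _ => by rw [hcorr]; ring
      simp only [e1, hW']
      rw [mul_add]
      congr 1
      · rw [mul_left_comm, Finset.mul_sum _ _ (Real.sin θ * Real.cos θ)]
        congr 1
        exact Finset.sum_congr rfl fun x _ => by ring
      · rw [mul_left_comm, Finset.mul_sum _ _ (Real.sin θ * Real.cos θ)]
        congr 1
        exact Finset.sum_congr rfl fun x _ => by ring
    simp_rw [hfun] at hθint ⊢
    rw [integrable_const_mul_iff hsc.ne'.isUnit] at hθint
    rw [integral_const_mul]
    have h1 := mul_le_mul_of_nonneg_left (hD θ hθint) hsc.le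
    push_cast
    linarith
  have h := hanti (Set.left_mem_Icc.2 (by positivity)) (Set.right_mem_Icc.2 (by positivity))
    (show (0 : ℝ) ≤ π / 2 by positivity)
  have hπ : φ (π / 2) = ∫ z, Φ (channelZ w a U z) ∂stdGaussPi ι := by
    rw [← integral_comp_inl (κ := κ) (hΦ.continuous_comp_channelZ hw hw1 a U)]
    simp only [hφ, channelZ, channelEnergy, rotSignal, rotEnergy, Fintype.sum_sum_type,
      Sum.elim_inl, Sum.elim_inr, Real.sin_pi_div_two, Real.cos_pi_div_two]
    norm_num
  have h0 : φ 0 = ∫ z, Φ (channelZ w b V z) ∂stdGaussPi κ := by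
    rw [← integral_comp_inr (ι := ι) (hΦ.continuous_comp_channelZ hw hw1 b V)]
    simp only [hφ, channelZ, channelEnergy, rotSignal, rotEnergy, Fintype.sum_sum_type,
      Sum.elim_inl, Sum.elim_inr, Real.sin_zero, Real.cos_zero]
    norm_num
  simp only [Pi.sub_apply, Pi.pow_apply, Real.sin_zero, Real.sin_pi_div_two] at h
  rw [← hπ, ← h0]
  linarith

end Rotation

section Comparison

lemma tameC2_log : TameC2 Real.log (fun u => u⁻¹) (fun u => -(u ^ 2)⁻¹) where
  deriv1 u hu := Real.hasDerivAt_log hu.ne'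
  deriv2 u hu := hasDerivAt_inv hu.ne'
  cont := ((continuousOn_id.pow 2).inv₀ fun u hu => pow_ne_zero 2 (ne_of_gt hu)).neg
  bound0 u _ := by
    linarith [Real.add_one_le_exp (2 * |Real.log u|), abs_nonneg (Real.log u)]
  bound1 u hu := by
    rw [abs_of_pos (inv_pos.2 hu)]
    nth_rewrite 1 [← Real.exp_log hu]
    rw [← Real.exp_neg]
    exact Real.exp_le_exp.2 (by linarith [neg_abs_le (Real.log u), abs_nonneg (Real.log u)])
  bound2 u hu := by
    rw [abs_neg, abs_of_pos (by positivity)]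
    nth_rewrite 1 [← Real.exp_log hu]
    rw [← Real.exp_nat_mul, ← Real.exp_neg]
    refine Real.exp_le_exp.2 ?_
    push_cast
    linarith [neg_abs_le (Real.log u), abs_nonneg (Real.log u)]

lemma tameC2_mul_log : TameC2 (fun u => u * Real.log u) (fun u => Real.log u + 1)
    (fun u => u⁻¹) where
  deriv1 u hu := Real.hasDerivAt_mul_log hu.ne'
  deriv2 u hu := (Real.hasDerivAt_log hu.ne').add_const 1
  cont := continuousOn_id.inv₀ fun u hu => ne_of_gt hu
  bound0 u hu := by
    rw [abs_mul, abs_of_pos hu, two_mul, Real.exp_add]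
    refine mul_le_mul ?_ ?_ (abs_nonneg _) (Real.exp_pos _).le
    · nth_rewrite 1 [← Real.exp_log hu]
      exact Real.exp_le_exp.2 (le_abs_self _)
    · linarith [Real.add_one_le_exp |Real.log u|]
  bound1 u _ := by
    refine (abs_add_le _ _).trans ?_
    rw [abs_one]
    linarith [Real.add_one_le_exp (2 * |Real.log u|), abs_nonneg (Real.log u)]
  bound2 u hu := tameC2_log.bound1 u hu

variable {Ω ι κ : Type*} [Fintype ι] [Fintype κ] [Fintype Ω] {w : Ω → ℝ}

lemma gibbs_double_sum_le {g : Ω → ℝ} (hg : ∀ x, 0 ≤ g x) (f : Ω → ℝ) (C : Ω → Ω → ℝ)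
    (h : ∀ x y, C x y ≤ f x + f y) :
    ∑ x, g x * ∑ y, g y * C x y ≤ 2 * (∑ x, g x) * ∑ x, g x * f x := by
  have h1 : ∑ x, g x * ∑ y, g y * C x y ≤ ∑ x, g x * ∑ y, g y * (f x + f y) :=
    Finset.sum_le_sum fun x _ => mul_le_mul_of_nonneg_left
      (Finset.sum_le_sum fun y _ => mul_le_mul_of_nonneg_left (h x y) (hg y)) (hg x)
  refine h1.trans (le_of_eq ?_)
  simp only [mul_add, Finset.sum_add_distrib, ← Finset.sum_mul]
  have h2 : ∀ x, g x * ((∑ y, g y) * f x) = (∑ y, g y) * (g x * f x) := fun x => by ring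
  simp only [h2, ← Finset.mul_sum]
  ring

/-- Comparison of the expected log-partition functions of two Gaussian channels. -/
lemma integral_log_channelZ_le (hw : ∀ x, 0 ≤ w x) (hw1 : ∑ x, w x = 1)
    (a : Ω → ι → ℝ) (b : Ω → κ → ℝ) (U V : Ω → ℝ) (D : ℝ)
    (h : ∀ x y, (U x - V x) + (U y - V y) - (∑ i, a x i * a y i - ∑ j, b x j * b y j) ≤ 2 * D) :
    ∫ z, Real.log (channelZ w a U z) ∂stdGaussPi ι
      ≤ ∫ z, Real.log (channelZ w b V z) ∂stdGaussPi κ + D := by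
  refine integral_channelZ_le_of_rot hw hw1 a b U V tameC2_log D fun θ hθint => ?_
  refine (integral_mono hθint (integrable_const (2 * D)) fun z => ?_).trans (by simp)
  have hpos := channelZ_pos hw hw1 (rotSignal a b θ) (rotEnergy U V θ) z
  have hZ : channelZ w (rotSignal a b θ) (rotEnergy U V θ) z
    = ∑ x, w x * Real.exp (channelEnergy (rotSignal a b θ) (rotEnergy U V θ) x z) := rfl
  set Z := channelZ w (rotSignal a b θ) (rotEnergy U V θ) z
  have hg : ∀ x, 0 ≤ w x * Real.exp (channelEnergy (rotSignal a b θ) (rotEnergy U V θ) x z) :=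
    fun x => mul_nonneg (hw x) (Real.exp_pos _).le
  have := gibbs_double_sum_le hg (fun x => D - (U x - V x))
    (fun x y => - (∑ i, a x i * a y i - ∑ j, b x j * b y j))
    fun x y => by linarith [h x y]
  set g : Ω → ℝ := fun x =>
    w x * Real.exp (channelEnergy (rotSignal a b θ) (rotEnergy U V θ) x z) with hgdef
  set C : Ω → Ω → ℝ := fun x y => ∑ i, a x i * a y i - ∑ j, b x j * b y j with hC
  have e1 : ∑ x, g x * (D - (U x - V x)) = Z * D - ∑ x, g x * (U x - V x) := by
    rw [hZ, Finset.sum_mul, ← Finset.sum_sub_distrib]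
    exact Finset.sum_congr rfl fun x _ => by ring
  have e2 : ∑ x, g x * ∑ y, g y * -C x y = -∑ x, g x * ∑ y, g y * C x y := by
    simp only [mul_neg, Finset.sum_neg_distrib]
  have e3 : ∑ x, w x * (Real.exp (channelEnergy (rotSignal a b θ) (rotEnergy U V θ) x z)
      * (2 * (U x - V x))) = 2 * ∑ x, g x * (U x - V x) := by
    rw [Finset.mul_sum]
    exact Finset.sum_congr rfl fun x _ => by simp only [hgdef]; ring
  have e4 : ∑ x, w x * (Real.exp (channelEnergy (rotSignal a b θ) (rotEnergy U V θ) x z)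
      * ∑ y, w y * (Real.exp (channelEnergy (rotSignal a b θ) (rotEnergy U V θ) y z)
        * C x y)) = ∑ x, g x * ∑ y, g y * C x y := by
    simp only [hgdef, mul_assoc]
  rw [e1, e2, ← hZ] at this
  rw [e3, e4]
  generalize ∑ x, g x * (U x - V x) = S at this ⊢
  generalize ∑ x, g x * ∑ y, g y * C x y = T at this ⊢
  have h5 : Z⁻¹ * (2 * S) + -(Z ^ 2)⁻¹ * T = (2 * Z * S - T) / Z ^ 2 := by
    field_simp
    ring
  rw [h5, div_le_iff₀ (by positivity)]
  linarith

/-- Comparison of the entropies of two Gaussian channels. -/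
lemma integral_mul_log_channelZ_le (hw : ∀ x, 0 ≤ w x) (hw1 : ∑ x, w x = 1)
    (a : Ω → ι → ℝ) (b : Ω → κ → ℝ) (g : Ω → ℝ)
    (h : ∀ x y, ∑ i, a x i * a y i - ∑ j, b x j * b y j ≤ g x + g y) :
    ∫ z, channelZ w a (fun _ => 0) z * Real.log (channelZ w a (fun _ => 0) z) ∂stdGaussPi ι
      ≤ ∫ z, channelZ w b (fun _ => 0) z * Real.log (channelZ w b (fun _ => 0) z) ∂stdGaussPi κ
        + ∑ x, w x * g x := by
  refine integral_channelZ_le_of_rot hw hw1 a b (fun _ => 0) (fun _ => 0) tameC2_mul_log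
    (∑ x, w x * g x) fun θ hθint => ?_
  have hW : rotEnergy (fun _ : Ω => (0 : ℝ)) (fun _ => 0) θ = fun _ => 0 := by
    funext x; simp [rotEnergy]
  rw [hW] at hθint ⊢
  have hexp1 : ∀ x, ∫ z, Real.exp (channelEnergy (rotSignal a b θ) (fun _ => 0) x z)
      ∂stdGaussPi (ι ⊕ κ) = 1 := fun x => by
    simp only [channelEnergy, add_zero]
    exact stdGaussPi_integral_exp _
  have hexpI : ∀ x, Integrable (fun z =>
      Real.exp (channelEnergy (rotSignal a b θ) (fun _ => 0) x z)) (stdGaussPi (ι ⊕ κ)) :=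
    fun x => not_imp_comm.1 integral_undef (by rw [hexp1]; norm_num)
  have hI : Integrable (fun z => ∑ x, 2 * (w x * g x) *
      Real.exp (channelEnergy (rotSignal a b θ) (fun _ => 0) x z)) (stdGaussPi (ι ⊕ κ)) :=
    integrable_finsetSum _ fun x _ => (hexpI x).const_mul _
  have hIeq : ∫ z, ∑ x, 2 * (w x * g x) *
      Real.exp (channelEnergy (rotSignal a b θ) (fun _ => 0) x z) ∂stdGaussPi (ι ⊕ κ)
      = 2 * ∑ x, w x * g x := by
    rw [integral_finsetSum _ fun x _ => (hexpI x).const_mul _, Finset.mul_sum]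
    exact Finset.sum_congr rfl fun x _ => by rw [integral_const_mul, hexp1, mul_one]
  refine (integral_mono hθint hI fun z => ?_).trans hIeq.le
  have hpos := channelZ_pos hw hw1 (rotSignal a b θ) (fun _ => 0) z
  have hZ : channelZ w (rotSignal a b θ) (fun _ => 0) z
    = ∑ x, w x * Real.exp (channelEnergy (rotSignal a b θ) (fun _ => 0) x z) := rfl
  have hg : ∀ x, 0 ≤ w x * Real.exp (channelEnergy (rotSignal a b θ) (fun _ => 0) x z) :=
    fun x => mul_nonneg (hw x) (Real.exp_pos _).le
  have := gibbs_double_sum_le hg g _ h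
  simp only [← mul_assoc, sub_zero, mul_zero, Finset.sum_const_zero, zero_add]
  rw [inv_mul_le_iff₀ hpos]
  refine this.trans (le_of_eq ?_)
  rw [← hZ, mul_comm 2, mul_assoc, Finset.mul_sum]
  congr 1
  exact Finset.sum_congr rfl fun x _ => by ring

end Comparison

section GibbsFreeEnergy

variable {Ω ι κ : Type*} [Fintype ι] [Fintype κ] [Fintype Ω] {w : Ω → ℝ}

/-- The free energy of the Gaussian channel with signal map `A` and prior weights `w`, the
observation being generated by a signal drawn from the prior. -/
def gibbsFE (w : Ω → ℝ) (A : Ω → ι → ℝ) : ℝ :=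
  ∑ X, w X * ∫ z, Real.log (channelZ w A (fun x => ∑ i, A x i * A X i) z) ∂stdGaussPi ι

lemma channelZ_add (w : Ω → ℝ) (A : Ω → ι → ℝ) (a z : ι → ℝ) :
    channelZ w A (fun _ => 0) (z + a) = channelZ w A (fun x => ∑ i, A x i * a i) z := by
  refine Finset.sum_congr rfl fun x _ => ?_
  congr 2
  simp only [channelEnergy, Pi.add_apply, add_zero]
  rw [← Finset.sum_add_distrib]
  exact Finset.sum_congr rfl fun i _ => by ring

lemma exists_channelZ_growth (hw : ∀ x, 0 ≤ w x) (hw1 : ∑ x, w x = 1) (A : Ω → ι → ℝ)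
    (W : Ω → ℝ) : ∃ c, 0 ≤ c ∧ ∀ z, (∀ x, |channelEnergy A W x z| ≤ c * (1 + ∑ i, |z i|)) ∧
      channelZ w A W z ≤ Real.exp (c * (1 + ∑ i, |z i|)) ∧
      |Real.log (channelZ w A W z)| ≤ c * (1 + ∑ i, |z i|) := by
  obtain ⟨K₁, hK₁, h₁⟩ := exists_bound_of_fintype fun p : Ω × ι => A p.1 p.2
  obtain ⟨K₂, hK₂, h₂⟩ := exists_bound_of_fintype W
  refine ⟨Fintype.card ι * (K₁ + K₂) ^ 2 + (K₁ + K₂), by positivity, fun z => ?_⟩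
  have h := fun x => abs_channelEnergy_le (A := A) (W := W) (K := K₁ + K₂)
    (fun x i => (h₁ (x, i)).trans (by linarith)) (fun x => (h₂ x).trans (by linarith)) x z
  exact ⟨h, (channelZ_bounds hw hw1 h).2⟩

lemma integrable_log_channelZ (hw : ∀ x, 0 ≤ w x) (hw1 : ∑ x, w x = 1) (A : Ω → ι → ℝ)
    (W : Ω → ℝ) : Integrable (fun z => Real.log (channelZ w A W z)) (stdGaussPi ι) := by
  obtain ⟨c, hc, h⟩ := exists_channelZ_growth hw hw1 A W
  refine stdGaussPi_integrable_of_le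
    (tameC2_log.continuous_comp_channelZ hw hw1 A W).aestronglyMeasurable
    (M := Real.exp c) (c := c) fun z => (h z).2.2.trans ?_
  rw [← Real.exp_add]
  linarith [Real.add_one_le_exp (c + c * ∑ i, |z i|)]

/-- Averaging a function of the observation over the signal amounts to weighting it by the
likelihood ratio. -/
lemma sum_integral_comp_add (hw : ∀ x, 0 ≤ w x) (hw1 : ∑ x, w x = 1) (A : Ω → ι → ℝ)
    {f : (ι → ℝ) → ℝ} (hf : Continuous f) {c : ℝ}
    (hb : ∀ z, |f z| ≤ c * (1 + ∑ i, |z i|)) :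
    Integrable (fun z => channelZ w A (fun _ => 0) z * f z) (stdGaussPi ι) ∧
    ∑ X, w X * ∫ z, f (z + A X) ∂stdGaussPi ι
      = ∫ z, channelZ w A (fun _ => 0) z * f z ∂stdGaussPi ι := by
  obtain ⟨d, hd, h⟩ := exists_channelZ_growth hw hw1 A (fun _ => 0)
  have hI : ∀ X, Integrable
      (fun z => Real.exp (channelEnergy A (fun _ => 0) X z) * f z) (stdGaussPi ι) := by
    intro X
    refine stdGaussPi_integrable_of_le (Continuous.aestronglyMeasurable
      ((continuous_channelEnergy A _ X).rexp.mul hf)) (M := Real.exp (d + c)) (c := d + c)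
      fun z => ?_
    rw [abs_mul, Real.abs_exp, ← Real.exp_add]
    have h1 : |f z| ≤ Real.exp (c * (1 + ∑ i, |z i|)) :=
      (hb z).trans (by linarith [Real.add_one_le_exp (c * (1 + ∑ i, |z i|))])
    calc _ ≤ Real.exp (d * (1 + ∑ i, |z i|)) * Real.exp (c * (1 + ∑ i, |z i|)) :=
          mul_le_mul (exp_le_of_abs_le ((h z).1 X)) h1 (abs_nonneg _) (Real.exp_pos _).le
      _ = _ := by rw [← Real.exp_add]; congr 1; ring
  have hfun : (fun z => channelZ w A (fun _ => 0) z * f z)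
      = fun z => ∑ X, w X * (Real.exp (channelEnergy A (fun _ => 0) X z) * f z) := by
    funext z
    simp only [channelZ, Finset.sum_mul, mul_assoc]
  rw [hfun]
  refine ⟨integrable_finsetSum _ fun X _ => (hI X).const_mul _, ?_⟩
  rw [integral_finsetSum _ fun X _ => (hI X).const_mul _]
  refine Finset.sum_congr rfl fun X _ => ?_
  rw [integral_const_mul, stdGaussPi_integral_comp_add _ hf.measurable]
  simp only [channelEnergy, add_zero]

lemma gibbsFE_eq_entropy (hw : ∀ x, 0 ≤ w x) (hw1 : ∑ x, w x = 1) (A : Ω → ι → ℝ) :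
    gibbsFE w A = ∫ z, channelZ w A (fun _ => 0) z * Real.log (channelZ w A (fun _ => 0) z)
      ∂stdGaussPi ι := by
  obtain ⟨c, -, h⟩ := exists_channelZ_growth hw hw1 A (fun _ => 0)
  rw [← (sum_integral_comp_add hw hw1 A
    (tameC2_log.continuous_comp_channelZ hw hw1 A (fun _ => 0)) fun z => (h z).2.2).2]
  simp only [gibbsFE, channelZ_add]

/-- Comparison of the free energies of two Gaussian channels from their overlaps. -/
lemma gibbsFE_le (hw : ∀ x, 0 ≤ w x) (hw1 : ∑ x, w x = 1)
    (a : Ω → ι → ℝ) (b : Ω → κ → ℝ) (g : Ω → ℝ)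
    (h : ∀ x y, ∑ i, a x i * a y i - ∑ j, b x j * b y j ≤ g x + g y) :
    gibbsFE w a ≤ gibbsFE w b + ∑ x, w x * g x := by
  rw [gibbsFE_eq_entropy hw hw1, gibbsFE_eq_entropy hw hw1]
  exact integral_mul_log_channelZ_le hw hw1 a b g h

lemma integrable_channelZ (w : Ω → ℝ) (A : Ω → ι → ℝ) :
    Integrable (channelZ w A fun _ => 0) (stdGaussPi ι) ∧
      ∫ z, channelZ w A (fun _ => 0) z ∂stdGaussPi ι = ∑ x, w x := by
  have hexp1 : ∀ x, ∫ z, Real.exp (channelEnergy A (fun _ => 0) x z) ∂stdGaussPi ι = 1 :=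
    fun x => by
      simp only [channelEnergy, add_zero]
      exact stdGaussPi_integral_exp _
  have hexpI : ∀ x, Integrable (fun z => Real.exp (channelEnergy A (fun _ => 0) x z))
      (stdGaussPi ι) := fun x => not_imp_comm.1 integral_undef (by rw [hexp1]; norm_num)
  refine ⟨integrable_finsetSum _ fun x _ => (hexpI x).const_mul _, ?_⟩
  unfold channelZ
  rw [integral_finsetSum _ fun x _ => (hexpI x).const_mul _]
  exact Finset.sum_congr rfl fun x _ => by rw [integral_const_mul, hexp1, mul_one]

/-- Flipping the sign of the signal in the log-partition function decreases the free energy. -/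
lemma sum_integral_log_flip_le (hw : ∀ x, 0 ≤ w x) (hw1 : ∑ x, w x = 1) (A : Ω → ι → ℝ) :
    ∑ X, w X * ∫ z, Real.log (channelZ w A (fun x => -∑ i, A x i * A X i) z) ∂stdGaussPi ι
      ≤ gibbsFE w A := by
  have hneg : MeasurePreserving (fun z : ι → ℝ => -z) (stdGaussPi ι) (stdGaussPi ι) :=
    measurePreserving_pi _ _ fun _ => measurePreserving_neg_stdGauss
  have hS := tameC2_log.continuous_comp_channelZ hw hw1 A (fun _ => 0)
  obtain ⟨c, -, h⟩ := exists_channelZ_growth hw hw1 A (fun _ => 0)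
  have hSn : Continuous fun z : ι → ℝ => Real.log (channelZ w A (fun _ => 0) (-z)) :=
    hS.comp continuous_neg
  have k1 := sum_integral_comp_add hw hw1 A hS fun z => (h z).2.2
  have k2 := sum_integral_comp_add hw hw1 A hSn (c := c) fun z => by
    simpa using (h (-z)).2.2
  have e1 : ∀ X, ∫ z, Real.log (channelZ w A (fun x => -∑ i, A x i * A X i) z) ∂stdGaussPi ι
      = ∫ z, Real.log (channelZ w A (fun _ => 0) (-(z + A X))) ∂stdGaussPi ι := by
    intro X
    have hc := tameC2_log.continuous_comp_channelZ hw hw1 A (fun x => -∑ i, A x i * A X i)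
    conv_lhs => rw [← hneg.map_eq]
    rw [integral_map hneg.measurable.aemeasurable hc.aestronglyMeasurable]
    refine integral_congr_ae (ae_of_all _ fun z => ?_)
    dsimp only
    rw [neg_add, channelZ_add]
    simp
  simp only [e1]
  rw [k2.2, gibbsFE_eq_entropy hw hw1]
  have i1 := integrable_channelZ w A
  have i2 : Integrable (fun z => channelZ w A (fun _ => 0) (-z)) (stdGaussPi ι) :=
    hneg.integrable_comp_of_integrable i1.1
  have i3 : ∫ z, channelZ w A (fun _ => 0) (-z) ∂stdGaussPi ι
      = ∫ z, channelZ w A (fun _ => 0) z ∂stdGaussPi ι := by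
    conv_rhs => rw [← hneg.map_eq]
    rw [integral_map hneg.measurable.aemeasurable
      (continuous_channelZ w A _).aestronglyMeasurable]
  have key := integral_mono k2.1 ((k1.1.add i2).sub i1.1) fun z => by
    have p1 := channelZ_pos hw hw1 A (fun _ => 0) z
    have p2 := channelZ_pos hw hw1 A (fun _ => 0) (-z)
    have := Real.log_le_sub_one_of_pos (div_pos p2 p1)
    rw [Real.log_div p2.ne' p1.ne'] at this
    have h2 := mul_le_mul_of_nonneg_left this p1.le
    have h3 : channelZ w A (fun _ => 0) z
        * (channelZ w A (fun _ => 0) (-z) / channelZ w A (fun _ => 0) z - 1)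
        = channelZ w A (fun _ => 0) (-z) - channelZ w A (fun _ => 0) z := by
      field_simp
    simp only [Pi.add_apply, Pi.sub_apply]
    linarith
  refine key.trans (le_of_eq ?_)
  rw [integral_sub' (k1.1.add i2) i1.1, integral_add' k1.1 i2, i3]
  ring

end GibbsFreeEnergy

section ProductPrior

/-- Quantitative weak law of large numbers in `L¹`. -/
lemma integral_abs_sum_sub_le {n : ℕ} {E : Type*} [MeasurableSpace E] (μ : Measure E)
    [IsProbabilityMeasure μ] {X : Fin n → E → ℝ} (hX : ∀ i, MemLp (X i) 2 μ) {C : ℝ}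
    (hC : ∀ i, Var[X i; μ] ≤ C) :
    Integrable (fun e : Fin n → E => |∑ i, X i (e i) - ∑ i, ∫ t, X i t ∂μ|)
      (Measure.pi fun _ : Fin n => μ) ∧
    ∫ e, |∑ i, X i (e i) - ∑ i, ∫ t, X i t ∂μ| ∂(Measure.pi fun _ : Fin n => μ) ≤ √(n * C) := by
  set P := Measure.pi fun _ : Fin n => μ with hP
  have hXi : ∀ i, MemLp (fun e : Fin n → E => X i (e i)) 2 P := fun i =>
    (hX i).comp_measurePreserving (measurePreserving_eval (fun _ : Fin n => μ) i)
  set S : (Fin n → E) → ℝ := ∑ i, fun e => X i (e i) with hS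
  have hS2 : MemLp S 2 P := memLp_finsetSum' _ fun i _ => hXi i
  have hmean : P[S] = ∑ i, ∫ t, X i t ∂μ := by
    simp only [hS, Finset.sum_apply]
    rw [integral_finsetSum _ fun i _ => (hXi i).integrable (by norm_num)]
    exact Finset.sum_congr rfl fun i _ => integral_comp_eval (hX i).aestronglyMeasurable
  have hvar : Var[S; P] = ∑ i, Var[X i; μ] := variance_sum_pi hX
  have hvar' : Var[S; P] ≤ n * C := by
    rw [hvar]
    refine (Finset.sum_le_sum fun i _ => hC i).trans (le_of_eq ?_)
    simp
  have hY : MemLp (fun e => |S e - ∑ i, ∫ t, X i t ∂μ|) 2 P := (hS2.sub (memLp_const _)).abs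
  have hSapp : ∀ e, S e = ∑ i, X i (e i) := fun e => by simp [hS]
  simp only [hSapp] at hY
  refine ⟨hY.integrable (by norm_num), Real.le_sqrt_of_sq_le ?_⟩
  have h1 := variance_nonneg (fun e : Fin n → E => |∑ i, X i (e i) - ∑ i, ∫ t, X i t ∂μ|) P
  rw [variance_eq_sub hY] at h1
  have h2 : P[(fun e : Fin n → E => |∑ i, X i (e i) - ∑ i, ∫ t, X i t ∂μ|) ^ 2] = Var[S; P] := by
    rw [variance_eq_integral hS2.aestronglyMeasurable.aemeasurable, hmean]
    refine integral_congr_ae (ae_of_all _ fun e => ?_)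
    simp only [Pi.pow_apply, sq_abs, hSapp]
  rw [h2] at h1
  linarith

variable {κ : Type*}

/-- The weights of the `n`-fold product of the probability weights `p`. -/
def prodWeight (p : κ → ℝ) (n : ℕ) (σ : Fin n → κ) : ℝ := ∏ i, p (σ i)

variable {p : κ → ℝ}

lemma prodWeight_nonneg (hp : ∀ k, 0 ≤ p k) (n : ℕ) (σ : Fin n → κ) : 0 ≤ prodWeight p n σ :=
  Finset.prod_nonneg fun _ _ => hp _

variable [Fintype κ]

lemma sum_prod_eval (n : ℕ) (f : Fin n → κ → ℝ) :
    ∑ σ : Fin n → κ, ∏ i, f i (σ i) = ∏ i, ∑ k, f i k := by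
  rw [Finset.prod_univ_sum, Fintype.piFinset_univ]

lemma sum_prodWeight (hp1 : ∑ k, p k = 1) (n : ℕ) : ∑ σ, prodWeight p n σ = 1 := by
  unfold prodWeight
  rw [sum_prod_eval n fun _ => p]
  simp [hp1]

lemma sum_prodWeight_mul_eval (hp1 : ∑ k, p k = 1) {n : ℕ} (i : Fin n) (h : κ → ℝ) :
    ∑ σ, prodWeight p n σ * h (σ i) = ∑ k, p k * h k := by
  have h1 : ∀ σ : Fin n → κ, prodWeight p n σ * h (σ i)
      = ∏ j, p (σ j) * (if j = i then h (σ j) else 1) := by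
    intro σ
    rw [Finset.prod_mul_distrib, Finset.prod_ite_eq' Finset.univ i]
    simp [prodWeight]
  simp only [h1]
  rw [sum_prod_eval n fun j k => p k * (if j = i then h k else 1), Finset.prod_eq_single i]
  · simp
  · intro j _ hj
    simp [hj, hp1]
  · simp

lemma sum_prodWeight_mul_sum (hp1 : ∑ k, p k = 1) (n : ℕ) (h : κ → ℝ) :
    ∑ σ, prodWeight p n σ * ∑ i, h (σ i) = n * ∑ k, p k * h k := by
  simp only [Finset.mul_sum]
  rw [Finset.sum_comm]
  simp only [sum_prodWeight_mul_eval hp1, Finset.sum_const, Finset.card_univ, Fintype.card_fin,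
    nsmul_eq_mul, Finset.mul_sum]

lemma integral_pi_eq_sum_prodWeight [MeasurableSpace κ] [MeasurableSingletonClass κ]
    (ν : Measure κ) [IsProbabilityMeasure ν] (n : ℕ) (f : (Fin n → κ) → ℝ) :
    ∫ σ, f σ ∂(Measure.pi fun _ : Fin n => ν)
      = ∑ σ, prodWeight (fun k => ν.real {k}) n σ * f σ := by
  rw [integral_fintype Integrable.of_finite]
  refine Finset.sum_congr rfl fun σ _ => ?_
  rw [smul_eq_mul, prodWeight, measureReal_def, Measure.pi_singleton, ENNReal.toReal_prod]
  rfl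

/-- The scalar channel partition function with signal-to-noise ratio `γ` and extra field `s`. -/
def scalarZ (p v : κ → ℝ) (γ s z : ℝ) : ℝ :=
  ∑ k, p k * Real.exp (√γ * v k * z - (√γ * v k) ^ 2 / 2 + s * v k)

/-- The scalar free energy of a prior with weights `p` and values `v`. -/
def scalarGibbsFE (p v : κ → ℝ) (γ : ℝ) : ℝ :=
  gibbsFE p fun k (_ : Unit) => √γ * v k

lemma scalarZ_eq_channelZ (p v : κ → ℝ) (γ s : ℝ) (z : Unit → ℝ) :
    scalarZ p v γ s (z ()) = channelZ p (fun k (_ : Unit) => √γ * v k) (fun k => s * v k) z := by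
  simp [scalarZ, channelZ, channelEnergy]

lemma scalarZ_pos (hp : ∀ k, 0 ≤ p k) (hp1 : ∑ k, p k = 1) (v : κ → ℝ) (γ s z : ℝ) :
    0 < scalarZ p v γ s z := by
  have := scalarZ_eq_channelZ p v γ s fun _ => z
  rw [this]
  exact channelZ_pos hp hp1 _ _ _

lemma integral_comp_unit {f : ℝ → ℝ} :
    ∫ z : Unit → ℝ, f (z ()) ∂stdGaussPi Unit = ∫ z, f z ∂stdGauss :=
  (measurePreserving_funUnique stdGauss Unit).integral_comp
    (MeasurableEquiv.measurableEmbedding _) f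

lemma scalarGibbsFE_eq (p v : κ → ℝ) {γ : ℝ} (hγ : 0 ≤ γ) :
    scalarGibbsFE p v γ
      = ∑ X, p X * ∫ z, Real.log (scalarZ p v γ (γ * v X) z) ∂stdGauss := by
  refine Finset.sum_congr rfl fun X _ => ?_
  rw [← integral_comp_unit]
  simp only [scalarZ_eq_channelZ]
  have : (fun k => ∑ _i : Unit, √γ * v k * (√γ * v X)) = fun k => γ * v X * v k := by
    funext k
    rw [Fintype.sum_unique]
    nth_rewrite 3 [← Real.mul_self_sqrt hγ]
    ring
  rw [this]

lemma sum_integral_log_scalarZ_neg_le (hp : ∀ k, 0 ≤ p k) (hp1 : ∑ k, p k = 1) (v : κ → ℝ)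
    {γ : ℝ} (hγ : 0 ≤ γ) :
    ∑ X, p X * ∫ z, Real.log (scalarZ p v γ (-(γ * v X)) z) ∂stdGauss
      ≤ scalarGibbsFE p v γ := by
  refine le_trans (le_of_eq ?_) (sum_integral_log_flip_le hp hp1 _)
  refine Finset.sum_congr rfl fun X _ => ?_
  rw [← integral_comp_unit]
  simp only [scalarZ_eq_channelZ]
  have : (fun k => -∑ _i : Unit, √γ * v k * (√γ * v X)) = fun k => -(γ * v X) * v k := by
    funext k
    rw [Fintype.sum_unique]
    nth_rewrite 3 [← Real.mul_self_sqrt hγ]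
    ring
  rw [this]

lemma continuous_scalarZ (p v : κ → ℝ) (γ s : ℝ) : Continuous (scalarZ p v γ s) := by
  unfold scalarZ; fun_prop

lemma memLp_log_scalarZ (hp : ∀ k, 0 ≤ p k) (hp1 : ∑ k, p k = 1) (v : κ → ℝ) (γ s : ℝ) :
    MemLp (fun z => Real.log (scalarZ p v γ s z)) 2 stdGauss := by
  obtain ⟨c, hc, h⟩ := exists_channelZ_growth hp hp1 (fun k (_ : Unit) => √γ * v k)
    (fun k => s * v k)
  have hcont : Continuous fun z => Real.log (scalarZ p v γ s z) :=
    (continuous_scalarZ p v γ s).log fun z => (scalarZ_pos hp hp1 v γ s z).ne'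
  have hb : ∀ z, |Real.log (scalarZ p v γ s z)| ≤ c * (1 + |z|) := by
    intro z
    have := (h fun _ => z).2.2
    rw [← scalarZ_eq_channelZ] at this
    simpa using this
  rw [memLp_two_iff_integrable_sq hcont.aestronglyMeasurable]
  refine ((stdGauss_integrable_exp_mul_abs (2 * c)).const_mul (Real.exp (2 * c))).mono'
    (hcont.pow 2).aestronglyMeasurable (ae_of_all _ fun z => ?_)
  rw [Real.norm_eq_abs, abs_pow, ← Real.exp_add]
  have h1 : |Real.log (scalarZ p v γ s z)| ≤ Real.exp (c * (1 + |z|)) :=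
    (hb z).trans (by linarith [Real.add_one_le_exp (c * (1 + |z|))])
  calc _ ≤ Real.exp (c * (1 + |z|)) ^ 2 := pow_le_pow_left₀ (abs_nonneg _) h1 2
    _ = _ := by
      rw [← Real.exp_nat_mul]
      congr 1
      push_cast
      ring

lemma channelZ_prodWeight (p v : κ → ℝ) {n : ℕ} (γ : ℝ) (s z : Fin n → ℝ) :
    channelZ (prodWeight p n) (fun σ i => √γ * v (σ i)) (fun σ => ∑ i, s i * v (σ i)) z
      = ∏ i, scalarZ p v γ (s i) (z i) := by
  unfold scalarZ
  rw [← sum_prod_eval n fun i k =>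
    p k * Real.exp (√γ * v k * z i - (√γ * v k) ^ 2 / 2 + s i * v k)]
  refine Finset.sum_congr rfl fun σ _ => ?_
  rw [Finset.prod_mul_distrib, ← Real.exp_sum, prodWeight, channelEnergy, ← Finset.sum_add_distrib]

/-- The free energy of `n` independent scalar channels. -/
lemma gibbsFE_prodWeight (hp : ∀ k, 0 ≤ p k) (hp1 : ∑ k, p k = 1) (v : κ → ℝ) (n : ℕ)
    {γ : ℝ} (hγ : 0 ≤ γ) :
    gibbsFE (prodWeight p n) (fun σ (i : Fin n) => √γ * v (σ i)) = n * scalarGibbsFE p v γ := by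
  rw [scalarGibbsFE_eq p v hγ, ← sum_prodWeight_mul_sum hp1]
  refine Finset.sum_congr rfl fun X _ => ?_
  have h1 : (fun σ : Fin n → κ => ∑ i, √γ * v (σ i) * (√γ * v (X i)))
      = fun σ => ∑ i, γ * v (X i) * v (σ i) := by
    funext σ
    refine Finset.sum_congr rfl fun i _ => ?_
    nth_rewrite 3 [← Real.mul_self_sqrt hγ]
    ring
  have h2 : ∀ i, Integrable (fun z : Fin n → ℝ => Real.log (scalarZ p v γ (γ * v (X i)) (z i)))
      (stdGaussPi (Fin n)) := fun i =>
    integrable_comp_eval (μ := fun _ : Fin n => stdGauss)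
      ((memLp_log_scalarZ hp hp1 v γ (γ * v (X i))).integrable (by norm_num))
  rw [h1]
  simp only [channelZ_prodWeight]
  simp_rw [Real.log_prod fun i _ => (scalarZ_pos hp hp1 v _ _ _).ne']
  rw [integral_finsetSum _ fun i _ => h2 i]
  congr 1
  refine Finset.sum_congr rfl fun i _ => ?_
  exact integral_comp_eval (μ := fun _ : Fin n => stdGauss)
    (memLp_log_scalarZ hp hp1 v γ (γ * v (X i))).aestronglyMeasurable

end ProductPrior

section FinitePrior

/-- The signal `√(λ/n) x_i x_j`, `i < j`, of the spiked Wigner model. -/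
def wignerSignal (n : ℕ) (lam : ℝ) (x : Fin n → ℝ) (e : Fin n × Fin n) : ℝ :=
  if e.1 < e.2 then √(lam / n) * x e.1 * x e.2 else 0

lemma two_mul_sum_pairs {n : ℕ} (c : Fin n → ℝ) :
    2 * ∑ e : Fin n × Fin n, (if e.1 < e.2 then c e.1 * c e.2 else 0)
      = (∑ i, c i) ^ 2 - ∑ i, c i ^ 2 := by
  have h1 : (∑ i, c i) ^ 2 = ∑ e : Fin n × Fin n, c e.1 * c e.2 := by
    rw [sq, Finset.sum_mul_sum, ← Finset.univ_product_univ, Finset.sum_product]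
  have h2 : ∑ i, c i ^ 2 = ∑ e : Fin n × Fin n, (if e.1 = e.2 then c e.1 * c e.2 else 0) := by
    rw [← Finset.univ_product_univ, Finset.sum_product]
    refine Finset.sum_congr rfl fun i _ => ?_
    simp [sq]
  have h3 : ∑ e : Fin n × Fin n, (if e.1 < e.2 then c e.1 * c e.2 else 0)
      = ∑ e : Fin n × Fin n, (if e.2 < e.1 then c e.1 * c e.2 else 0) := by
    rw [← (Equiv.prodComm (Fin n) (Fin n)).sum_comp]
    refine Finset.sum_congr rfl fun e _ => ?_
    simp [mul_comm]
  rw [two_mul]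
  nth_rewrite 2 [h3]
  rw [h1, h2, ← Finset.sum_add_distrib, ← Finset.sum_sub_distrib]
  refine Finset.sum_congr rfl fun e _ => ?_
  rcases lt_trichotomy e.1 e.2 with h | h | h
  · simp [h, h.ne, h.not_gt]
  · simp [h]
  · simp [h, h.ne', h.not_gt]

lemma sum_wignerSignal_mul {n : ℕ} {lam : ℝ} (hlam : 0 ≤ lam) (x y : Fin n → ℝ) :
    ∑ e, wignerSignal n lam x e * wignerSignal n lam y e
      = lam / (2 * n) * ((∑ i, x i * y i) ^ 2 - ∑ i, (x i * y i) ^ 2) := by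
  rw [← two_mul_sum_pairs]
  have h : ∀ e, wignerSignal n lam x e * wignerSignal n lam y e
      = lam / n * (if e.1 < e.2 then (x e.1 * y e.1) * (x e.2 * y e.2) else 0) := by
    intro e
    unfold wignerSignal
    split_ifs
    · nth_rewrite 3 [← Real.mul_self_sqrt (show 0 ≤ lam / n by positivity)]
      ring
    · simp
  simp only [h, ← Finset.mul_sum]
  rcases eq_or_ne (n : ℝ) 0 with hn | hn
  · simp [hn]
  · field_simp

variable {κ : Type*}

lemma sum_sq_le_of_abs_le {v : κ → ℝ} {n : ℕ} {K : ℝ} (hv : ∀ k, |v k| ≤ K) (x y : Fin n → κ) :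
    ∑ i, (v (x i) * v (y i)) ^ 2 ≤ n * K ^ 4 := by
  refine (Finset.sum_le_sum (g := fun _ => K ^ 4) fun i _ => ?_).trans (le_of_eq (by simp))
  rw [← sq_abs, abs_mul]
  calc (|v (x i)| * |v (y i)|) ^ 2 ≤ (K * K) ^ 2 :=
        pow_le_pow_left₀ (by positivity) (mul_le_mul (hv _) (hv _) (abs_nonneg _)
          ((abs_nonneg _).trans (hv (x i)))) 2
    _ = K ^ 4 := by ring

variable [Fintype κ]

/-- The free energy of the spiked Wigner model for a prior with weights `p` and values `v`. -/
def wignerGibbsFE (p v : κ → ℝ) (n : ℕ) (lam : ℝ) : ℝ :=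
  gibbsFE (prodWeight p n) fun σ => wignerSignal n lam fun i => v (σ i)

variable {p v : κ → ℝ}

/-- Guerra's lower bound. -/
lemma le_wignerGibbsFE (hp : ∀ k, 0 ≤ p k) (hp1 : ∑ k, p k = 1) {K : ℝ} (hv : ∀ k, |v k| ≤ K)
    {lam : ℝ} (hlam : 0 ≤ lam) {q : ℝ} (hq : 0 ≤ q) {n : ℕ} (hn : 0 < n) :
    n * (scalarGibbsFE p v (lam * q) - lam / 4 * q ^ 2)
      ≤ wignerGibbsFE p v n lam + lam * K ^ 4 / 4 := by
  have hn' : (0 : ℝ) < n := by exact_mod_cast hn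
  have hγ : 0 ≤ lam * q := mul_nonneg hlam hq
  have key := gibbsFE_le (prodWeight_nonneg hp n) (sum_prodWeight hp1 n)
    (fun σ (i : Fin n) => √(lam * q) * v (σ i))
    (fun σ => wignerSignal n lam fun i => v (σ i))
    (fun _ => n * (lam / 4 * q ^ 2) + lam * K ^ 4 / 4) (by
      intro x y
      rw [sum_wignerSignal_mul hlam]
      have h1 : ∑ i, √(lam * q) * v (x i) * (√(lam * q) * v (y i))
          = lam * q * ∑ i, v (x i) * v (y i) := by
        rw [Finset.mul_sum]
        refine Finset.sum_congr rfl fun i _ => ?_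
        nth_rewrite 3 [← Real.mul_self_sqrt hγ]
        ring
      rw [h1]
      have h2 := sum_sq_le_of_abs_le hv x y
      generalize ∑ i, v (x i) * v (y i) = T at *
      generalize ∑ i, (v (x i) * v (y i)) ^ 2 = Q at *
      have h3 : lam / (2 * n) * Q ≤ lam / (2 * n) * (n * K ^ 4) :=
        mul_le_mul_of_nonneg_left h2 (by positivity)
      have h4 : lam / (2 * n) * (n * K ^ 4) = lam * K ^ 4 / 2 := by field_simp
      have h5 : 0 ≤ lam / (2 * n) * (T - n * q) ^ 2 := by positivity
      have h6 : lam / (2 * n) * (T - n * q) ^ 2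
          = lam / (2 * n) * T ^ 2 - lam * q * T + n * (lam / 2 * q ^ 2) := by
        field_simp
        ring
      nlinarith)
  rw [gibbsFE_prodWeight hp hp1 v n hγ, ← Finset.sum_mul, sum_prodWeight hp1, one_mul] at key
  unfold wignerGibbsFE
  linarith

/-- The law of large numbers for the log-partition functions of `n` scalar channels. -/
lemma exists_sum_integral_abs_le [MeasurableSpace κ] [MeasurableSingletonClass κ]
    (ν : Measure κ) [IsProbabilityMeasure ν] (v s : κ → ℝ) (γ : ℝ) :
    ∃ C, 0 ≤ C ∧ ∀ n : ℕ, ∑ σ : Fin n → κ, prodWeight (fun k => ν.real {k}) n σ *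
      ∫ z, |∑ i, Real.log (scalarZ (fun k => ν.real {k}) v γ (s (σ i)) (z i))
        - n * ∑ k, ν.real {k} * ∫ t, Real.log (scalarZ (fun k => ν.real {k}) v γ (s k) t)
          ∂stdGauss| ∂stdGaussPi (Fin n) ≤ √(n * C) := by
  set p : κ → ℝ := fun k => ν.real {k} with hpdef
  have hp : ∀ k, 0 ≤ p k := fun k => measureReal_nonneg
  have hp1 : ∑ k, p k = 1 := by
    simp [hpdef]
  set η : κ → ℝ := fun k => ∫ t, Real.log (scalarZ p v γ (s k) t) ∂stdGauss with hη
  obtain ⟨C₁, hC₁, h₁⟩ := exists_bound_of_fintype fun k =>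
    Var[fun t => Real.log (scalarZ p v γ (s k) t); stdGauss]
  set C₂ := Var[η; ν] with hC₂
  have hC₂0 : 0 ≤ C₂ := variance_nonneg _ _
  refine ⟨2 * (C₁ + C₂), by positivity, fun n => ?_⟩
  have hμ : ∑ k, p k * η k = ∫ k, η k ∂ν := by
    rw [integral_fintype Integrable.of_finite]
    rfl
  have A1 : ∀ σ : Fin n → κ, Integrable (fun z : Fin n → ℝ =>
        |∑ i, Real.log (scalarZ p v γ (s (σ i)) (z i)) - ∑ i, η (σ i)|) (stdGaussPi (Fin n)) ∧
      ∫ z, |∑ i, Real.log (scalarZ p v γ (s (σ i)) (z i)) - ∑ i, η (σ i)|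
        ∂stdGaussPi (Fin n) ≤ √(n * C₁) := fun σ =>
    integral_abs_sum_sub_le stdGauss (X := fun i t => Real.log (scalarZ p v γ (s (σ i)) t))
      (fun i => memLp_log_scalarZ hp hp1 v γ (s (σ i)))
      fun i => (le_abs_self _).trans (h₁ (σ i))
  have A2 : ∑ σ : Fin n → κ, prodWeight p n σ * |∑ i, η (σ i) - n * ∑ k, p k * η k|
      ≤ √(n * C₂) := by
    have := (integral_abs_sum_sub_le ν (n := n) (X := fun _ => η) (C := C₂)
      (fun _ => MemLp.of_discrete) fun _ => le_rfl).2
    rw [integral_pi_eq_sum_prodWeight] at this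
    rw [hμ]
    simpa using this
  have A3 : ∀ σ : Fin n → κ, ∫ z, |∑ i, Real.log (scalarZ p v γ (s (σ i)) (z i))
        - n * ∑ k, p k * η k| ∂stdGaussPi (Fin n)
      ≤ √(n * C₁) + |∑ i, η (σ i) - n * ∑ k, p k * η k| := by
    intro σ
    have hi := (A1 σ).1.add (integrable_const |∑ i, η (σ i) - n * ∑ k, p k * η k|)
    refine (integral_mono_of_nonneg (ae_of_all _ fun _ => abs_nonneg _) hi
      (ae_of_all _ fun z => abs_sub_le _ (∑ i, η (σ i)) _)).trans ?_
    rw [integral_add' (A1 σ).1 (integrable_const _)]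
    have := (A1 σ).2
    simpa using this
  calc _ ≤ ∑ σ : Fin n → κ, prodWeight p n σ *
        (√(n * C₁) + |∑ i, η (σ i) - n * ∑ k, p k * η k|) :=
        Finset.sum_le_sum fun σ _ => mul_le_mul_of_nonneg_left (A3 σ) (prodWeight_nonneg hp n σ)
    _ ≤ √(n * C₁) + √(n * C₂) := by
        simp only [mul_add, Finset.sum_add_distrib]
        rw [← Finset.sum_mul, sum_prodWeight hp1, one_mul]
        exact add_le_add le_rfl A2
    _ ≤ √(n * (2 * (C₁ + C₂))) := by
        refine Real.le_sqrt_of_sq_le ?_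
        have e1 := Real.sq_sqrt (show 0 ≤ n * C₁ by positivity)
        have e2 := Real.sq_sqrt (show 0 ≤ n * C₂ by positivity)
        nlinarith [sq_nonneg (√(n * C₁) - √(n * C₂))]

end FinitePrior

section UpperBound

variable {κ : Type*} [Fintype κ] {p v : κ → ℝ}

/-- Log-sum-exp bound around reference values. -/
lemma log_sum_exp_le {α : Type*} {L : Finset α} (hL : L.Nonempty) (S μ : α → ℝ) {B : ℝ}
    (hμ : ∀ l ∈ L, μ l ≤ B) :
    Real.log (∑ l ∈ L, Real.exp (S l)) ≤ Real.log L.card + B + ∑ l ∈ L, |S l - μ l| := by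
  have hc : (0 : ℝ) < L.card := by exact_mod_cast hL.card_pos
  rw [Real.log_le_iff_le_exp (Finset.sum_pos (fun _ _ => Real.exp_pos _) hL), Real.exp_add,
    Real.exp_add, Real.exp_log hc, mul_assoc, ← Real.exp_add]
  refine (Finset.sum_le_card_nsmul _ _ _ fun l hl => Real.exp_le_exp.2 ?_).trans
    (le_of_eq (nsmul_eq_mul _ _))
  have := Finset.single_le_sum (f := fun l => |S l - μ l|) (fun _ _ => abs_nonneg _) hl
  linarith [le_abs_self (S l - μ l), hμ l hl]

lemma integrable_log_sum_exp {α E : Type*} [MeasurableSpace E] {μ : Measure E} [IsFiniteMeasure μ]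
    {L : Finset α} (hL : L.Nonempty) {S : α → E → ℝ} (hS : ∀ l ∈ L, Integrable (S l) μ) :
    Integrable (fun z => Real.log (∑ l ∈ L, Real.exp (S l z))) μ := by
  have hA : Integrable (fun z => ∑ l ∈ L, |S l z|) μ :=
    integrable_finsetSum _ fun l hl => (hS l hl).abs
  have hmeas : AEMeasurable (fun z => ∑ l ∈ L, Real.exp (S l z)) μ :=
    Finset.aemeasurable_fun_sum _ fun l hl =>
      Real.measurable_exp.comp_aemeasurable (hS l hl).aestronglyMeasurable.aemeasurable
  refine (hA.add (integrable_const (Real.log L.card))).mono'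
    (Real.measurable_log.comp_aemeasurable hmeas).aestronglyMeasurable (ae_of_all _ fun z => ?_)
  obtain ⟨m, hm⟩ := hL
  have h0 : 0 ≤ Real.log L.card := Real.log_natCast_nonneg _
  have h1 := log_sum_exp_le ⟨m, hm⟩ (fun l => S l z) (fun _ => 0) (B := 0) fun _ _ => le_rfl
  have h2 : S m z ≤ Real.log (∑ l ∈ L, Real.exp (S l z)) := by
    rw [Real.le_log_iff_exp_le (Finset.sum_pos (fun _ _ => Real.exp_pos _) ⟨m, hm⟩)]
    exact Finset.single_le_sum (f := fun l => Real.exp (S l z)) (fun _ _ => (Real.exp_pos _).le) hm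
  have h3 := Finset.single_le_sum (f := fun l => |S l z|) (fun _ _ => abs_nonneg _) hm
  simp only [sub_zero] at h1
  rw [Real.norm_eq_abs, abs_le]
  simp only [Pi.add_apply]
  constructor <;> linarith [neg_abs_le (S m z)]

/-- Decoupling bound at a fixed signal `X`: the overlap with the signal is restricted to the
cells of the grid `ε ℤ`. -/
lemma integral_log_wigner_le (hp : ∀ k, 0 ≤ p k) (hp1 : ∑ k, p k = 1) {K : ℝ}
    (hv : ∀ k, |v k| ≤ K) {lam : ℝ} (hlam : 0 ≤ lam) {ε : ℝ} (hε : 0 < ε) {N : ℕ}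
    (hN : K ^ 2 / ε + 1 ≤ N) {n : ℕ} (hn : 0 < n) (X : Fin n → κ) :
    ∫ z, Real.log (channelZ (prodWeight p n) (fun σ => wignerSignal n lam fun i => v (σ i))
        (fun σ => ∑ e, wignerSignal n lam (fun i => v (σ i)) e
          * wignerSignal n lam (fun i => v (X i)) e) z) ∂stdGaussPi (Fin n × Fin n)
      ≤ ∫ z, Real.log (∑ l ∈ Finset.Icc (-(N : ℤ)) N,
          Real.exp (∑ i, Real.log (scalarZ p v (lam * |ε * l|) (lam * (ε * l) * v (X i)) (z i))
            - n * (lam / 4 * (ε * l) ^ 2))) ∂stdGaussPi (Fin n)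
        + (n * (lam * ε ^ 2 / 2) + lam * K ^ 4 / 4) := by
  have hn' : (0 : ℝ) < n := by exact_mod_cast hn
  set R : (Fin n → κ) → ℝ := fun σ => (∑ i, v (σ i) * v (X i)) / n with hR
  set l : (Fin n → κ) → ℤ := fun σ => ⌊R σ / ε⌋ with hl
  have hRb : ∀ σ, |R σ| ≤ K ^ 2 := by
    intro σ
    rw [hR, abs_div, abs_of_pos hn', div_le_iff₀ hn']
    refine (Finset.abs_sum_le_sum_abs _ _).trans
      ((Finset.sum_le_sum (g := fun _ => K ^ 2) fun i _ => ?_).trans (le_of_eq ?_))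
    · rw [abs_mul, sq]
      exact mul_le_mul (hv _) (hv _) (abs_nonneg _) ((abs_nonneg _).trans (hv (σ i)))
    · simp [mul_comm]
  have hlN : ∀ σ, l σ ∈ Finset.Icc (-(N : ℤ)) N := by
    intro σ
    have h1 : |R σ / ε| ≤ K ^ 2 / ε := by
      rw [abs_div, abs_of_pos hε]
      exact div_le_div_of_nonneg_right (hRb σ) hε.le
    rw [abs_le] at h1
    rw [Finset.mem_Icc]
    constructor
    · rw [hl, Int.le_floor]
      push_cast
      linarith
    · have := Int.floor_le (R σ / ε)
      have h2 : (l σ : ℝ) ≤ N := by linarith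
      exact_mod_cast h2
  have hlm : ∀ σ, 0 ≤ R σ - ε * l σ ∧ R σ - ε * l σ ≤ ε := by
    intro σ
    have h1 := Int.floor_le (R σ / ε)
    have h2 := Int.lt_floor_add_one (R σ / ε)
    rw [le_div_iff₀ hε] at h1
    rw [div_lt_iff₀ hε] at h2
    simp only [hl]
    constructor <;> nlinarith
  set b : (Fin n → κ) → Fin n → ℝ := fun σ i => √(lam * |ε * l σ|) * v (σ i) with hb
  set V : (Fin n → κ) → ℝ := fun σ =>
    ∑ i, lam * (ε * l σ) * v (X i) * v (σ i) - n * (lam / 4 * (ε * l σ) ^ 2) with hV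
  have hw := prodWeight_nonneg hp n
  have hw1 := sum_prodWeight hp1 n
  have step1 := integral_log_channelZ_le hw hw1
    (fun σ => wignerSignal n lam fun i => v (σ i)) b
    (fun σ => ∑ e, wignerSignal n lam (fun i => v (σ i)) e
          * wignerSignal n lam (fun i => v (X i)) e) V
    (n * (lam * ε ^ 2 / 2) + lam * K ^ 4 / 4) (by
      intro x y
      have hUV : ∀ x, (∑ e, wignerSignal n lam (fun i => v (x i)) e
          * wignerSignal n lam (fun i => v (X i)) e) - V x
          ≤ n * (lam * ε ^ 2 / 2) - n * (lam / 4 * (ε * l x) ^ 2) := by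
        intro x
        rw [sum_wignerSignal_mul hlam]
        have e1 : ∑ i, v (x i) * v (X i) = n * R x := by
          simp only [hR]; field_simp
        have e2 : V x = lam * (ε * l x) * (n * R x) - n * (lam / 4 * (ε * l x) ^ 2) := by
          simp only [hV, ← e1, Finset.mul_sum]
          congr 1
          exact Finset.sum_congr rfl fun i _ => by ring
        have e3 : 0 ≤ lam / (2 * n) * ∑ i, (v (x i) * v (X i)) ^ 2 :=
          mul_nonneg (by positivity) (Finset.sum_nonneg fun _ _ => sq_nonneg _)
        have e4 : lam / (2 * n) * (n * R x) ^ 2 = n * (lam / 2 * R x ^ 2) := by field_simp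
        have e5 : (R x - ε * l x) ^ 2 ≤ ε ^ 2 :=
          pow_le_pow_left₀ (hlm x).1 (hlm x).2 2
        have e6 := mul_le_mul_of_nonneg_left e5 (show 0 ≤ n * (lam / 2) by positivity)
        rw [e1, e2, mul_sub, e4]
        nlinarith
      have hC : -(n * (lam / 4 * (ε * l x) ^ 2) + n * (lam / 4 * (ε * l y) ^ 2))
            - lam * K ^ 4 / 2
          ≤ ∑ e, wignerSignal n lam (fun i => v (x i)) e * wignerSignal n lam (fun i => v (y i)) e
            - ∑ i, b x i * b y i := by
        rw [sum_wignerSignal_mul hlam]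
        set r := √(lam * |ε * l x|) * √(lam * |ε * l y|) with hr
        have e1 : ∑ i, b x i * b y i = r * ∑ i, v (x i) * v (y i) := by
          rw [Finset.mul_sum]
          exact Finset.sum_congr rfl fun i _ => by simp only [hb, hr]; ring
        have e2 : r ^ 2 = lam ^ 2 * (|ε * l x| * |ε * l y|) := by
          rw [hr, mul_pow, Real.sq_sqrt (by positivity), Real.sq_sqrt (by positivity)]
          ring
        have e3 := sum_sq_le_of_abs_le hv x y
        rw [e1]
        generalize ∑ i, v (x i) * v (y i) = T at *
        generalize ∑ i, (v (x i) * v (y i)) ^ 2 = Q at *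
        have e4 : lam / (2 * n) * Q ≤ lam / (2 * n) * (n * K ^ 4) :=
          mul_le_mul_of_nonneg_left e3 (by positivity)
        have e5 : lam / (2 * n) * (n * K ^ 4) = lam * K ^ 4 / 2 := by field_simp
        have e6 : |ε * l x| * |ε * l y| ≤ ((ε * l x) ^ 2 + (ε * l y) ^ 2) / 2 := by
          nlinarith [sq_nonneg (|ε * l x| - |ε * l y|), sq_abs (ε * l x), sq_abs (ε * l y)]
        rcases hlam.eq_or_lt with h0 | h0
        · subst h0
          have : r = 0 := by simp [hr]
          simp [this]
        · have e7 : 0 ≤ lam / (2 * n) * (T - n * r / lam) ^ 2 := by positivity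
          have e8 : lam / (2 * n) * (T - n * r / lam) ^ 2
              = lam / (2 * n) * T ^ 2 - r * T + n * (r ^ 2 / (2 * lam)) := by
            field_simp
            ring
          have e9 : r ^ 2 / (2 * lam) = lam / 2 * (|ε * l x| * |ε * l y|) := by
            rw [e2]; field_simp
          have e10 := mul_le_mul_of_nonneg_left e6 (show 0 ≤ n * (lam / 2) by positivity)
          rw [e8, e9] at e7
          nlinarith
      linarith [hUV x, hUV y])
  refine step1.trans (add_le_add ?_ le_rfl)
  have hle : ∀ z, channelZ (prodWeight p n) b V z ≤ ∑ m ∈ Finset.Icc (-(N : ℤ)) N,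
      Real.exp (∑ i, Real.log (scalarZ p v (lam * |ε * m|) (lam * (ε * m) * v (X i)) (z i))
            - n * (lam / 4 * (ε * m) ^ 2)) := by
    intro z
    have e1 : ∀ m : ℤ, Real.exp (∑ i, Real.log
        (scalarZ p v (lam * |ε * m|) (lam * (ε * m) * v (X i)) (z i))
            - n * (lam / 4 * (ε * m) ^ 2))
        = ∑ σ, prodWeight p n σ * Real.exp (channelEnergy
            (fun σ i => √(lam * |ε * m|) * v (σ i))
            (fun σ => ∑ i, lam * (ε * m) * v (X i) * v (σ i)
              - n * (lam / 4 * (ε * m) ^ 2)) σ z) := by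
      intro m
      rw [sub_eq_add_neg, Real.exp_add, Real.exp_sum]
      simp_rw [Real.exp_log (scalarZ_pos hp hp1 v _ _ _)]
      rw [← channelZ_prodWeight, channelZ, Finset.sum_mul]
      refine Finset.sum_congr rfl fun σ _ => ?_
      rw [mul_assoc, ← Real.exp_add]
      simp only [channelEnergy]
      congr 2
      ring
    simp only [e1]
    rw [Finset.sum_comm]
    refine Finset.sum_le_sum fun σ _ => ?_
    exact Finset.single_le_sum (f := fun m : ℤ => prodWeight p n σ * Real.exp (channelEnergy
            (fun σ i => √(lam * |ε * m|) * v (σ i))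
            (fun σ => ∑ i, lam * (ε * m) * v (X i) * v (σ i)
              - n * (lam / 4 * (ε * m) ^ 2)) σ z))
      (fun m _ => mul_nonneg (hw σ) (Real.exp_pos _).le) (hlN σ)
  have hI := integrable_log_channelZ hw hw1 b V
  refine integral_mono hI ?_ fun z => Real.log_le_log (channelZ_pos hw hw1 b V z) (hle z)
  refine integrable_log_sum_exp ⟨0, by simp⟩ fun m _ => Integrable.sub
    (integrable_finsetSum _ fun i _ => ?_) (integrable_const _)
  exact integrable_comp_eval (μ := fun _ : Fin n => stdGauss)
    ((memLp_log_scalarZ hp hp1 v _ _).integrable (by norm_num))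

end UpperBound

section UpperBound

variable {κ : Type*} [Fintype κ] [MeasurableSpace κ] [MeasurableSingletonClass κ]

/-- Upper bound on the free energy of a finitely supported prior: up to lower-order terms it is
at most any bound on the replica-symmetric potential. -/
lemma exists_wignerGibbsFE_le (ν : Measure κ) [IsProbabilityMeasure ν] (v : κ → ℝ) {lam B : ℝ}
    (hlam : 0 ≤ lam)
    (hB : ∀ q, 0 ≤ q → scalarGibbsFE (fun k => ν.real {k}) v (lam * q) - lam / 4 * q ^ 2 ≤ B)
    {ε : ℝ} (hε : 0 < ε) :
    ∃ C, 0 ≤ C ∧ ∀ n : ℕ, 0 < n → wignerGibbsFE (fun k => ν.real {k}) v n lam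
      ≤ n * (B + lam * ε ^ 2 / 2) + C * (1 + √n) := by
  set p : κ → ℝ := fun k => ν.real {k} with hpdef
  have hp : ∀ k, 0 ≤ p k := fun k => measureReal_nonneg
  have hp1 : ∑ k, p k = 1 := by
    simp [hpdef]
  obtain ⟨K, hK, hv⟩ := exists_bound_of_fintype v
  obtain ⟨N, hN⟩ := exists_nat_ge (K ^ 2 / ε + 1)
  set L := Finset.Icc (-(N : ℤ)) N with hLdef
  have hL : L.Nonempty := ⟨0, by simp [hLdef]⟩
  set m : ℤ → ℝ := fun l => ∑ k, p k * ∫ t, Real.log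
    (scalarZ p v (lam * |ε * l|) (lam * (ε * l) * v k) t) ∂stdGauss with hm
  have hmB : ∀ l : ℤ, m l - lam / 4 * (ε * l) ^ 2 ≤ B := by
    intro l
    refine le_trans ?_ (hB |ε * l| (abs_nonneg _))
    rw [sq_abs]
    refine sub_le_sub_right ?_ _
    rcases le_total 0 (ε * (l : ℝ)) with h | h
    · rw [scalarGibbsFE_eq p v (by positivity), abs_of_nonneg h, hm]
      simp only [abs_of_nonneg h, le_refl]
    · refine le_trans (le_of_eq ?_) (sum_integral_log_scalarZ_neg_le hp hp1 v (by positivity))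
      simp only [hm, abs_of_nonpos h]
      refine Finset.sum_congr rfl fun k _ => ?_
      congr 3
      funext t
      congr 2
      ring
  choose C hC0 hC using fun l : ℤ => exists_sum_integral_abs_le ν v
    (fun k => lam * (ε * l) * v k) (lam * |ε * l|)
  have hlog : 0 ≤ Real.log L.card := Real.log_natCast_nonneg _
  have hsq : 0 ≤ ∑ l ∈ L, √(C l) := Finset.sum_nonneg fun _ _ => Real.sqrt_nonneg _
  have hK4 : 0 ≤ lam * K ^ 4 / 4 := by positivity
  refine ⟨Real.log L.card + lam * K ^ 4 / 4 + ∑ l ∈ L, √(C l), by positivity, fun n hn => ?_⟩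
  have hSI : ∀ (l : ℤ) (X : Fin n → κ), Integrable (fun z : Fin n → ℝ =>
      ∑ i, Real.log (scalarZ p v (lam * |ε * l|) (lam * (ε * l) * v (X i)) (z i)))
      (stdGaussPi (Fin n)) := fun l X => integrable_finsetSum _ fun i _ =>
    integrable_comp_eval (μ := fun _ : Fin n => stdGauss)
      ((memLp_log_scalarZ hp hp1 v _ _).integrable (by norm_num))
  have hX : ∀ X : Fin n → κ, ∫ z, Real.log (channelZ (prodWeight p n)
      (fun σ => wignerSignal n lam fun i => v (σ i))
        (fun σ => ∑ e, wignerSignal n lam (fun i => v (σ i)) e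
          * wignerSignal n lam (fun i => v (X i)) e) z) ∂stdGaussPi (Fin n × Fin n)
      ≤ (Real.log L.card + n * B + (n * (lam * ε ^ 2 / 2) + lam * K ^ 4 / 4))
        + ∑ l ∈ L, ∫ z, |∑ i, Real.log
          (scalarZ p v (lam * |ε * l|) (lam * (ε * l) * v (X i)) (z i)) - n * m l|
          ∂stdGaussPi (Fin n) := by
    intro X
    refine (integral_log_wigner_le hp hp1 hv hlam hε hN hn X).trans ?_
    have h1 : ∀ z : Fin n → ℝ, Real.log (∑ l ∈ L,
          Real.exp (∑ i, Real.log (scalarZ p v (lam * |ε * l|) (lam * (ε * l) * v (X i)) (z i))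
            - n * (lam / 4 * (ε * l) ^ 2)))
        ≤ (Real.log L.card + n * B) + ∑ l ∈ L, |∑ i, Real.log
          (scalarZ p v (lam * |ε * l|) (lam * (ε * l) * v (X i)) (z i)) - n * m l| := by
      intro z
      refine (log_sum_exp_le hL _ (fun l => n * m l - n * (lam / 4 * (ε * l) ^ 2))
        (B := n * B) fun l _ => ?_).trans (le_of_eq ?_)
      · rw [← mul_sub]
        exact mul_le_mul_of_nonneg_left (hmB l) (Nat.cast_nonneg n)
      · congr 1
        refine Finset.sum_congr rfl fun l _ => ?_
        rw [sub_sub_sub_cancel_right]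
    have hAI : ∀ l ∈ L, Integrable (fun z : Fin n → ℝ => |∑ i, Real.log
        (scalarZ p v (lam * |ε * l|) (lam * (ε * l) * v (X i)) (z i)) - n * m l|)
        (stdGaussPi (Fin n)) := fun l _ => ((hSI l X).sub (integrable_const _)).abs
    have h2 := integral_mono (integrable_log_sum_exp hL fun l _ =>
        (hSI l X).sub (integrable_const (n * (lam / 4 * (ε * l) ^ 2))))
      ((integrable_const _).add (integrable_finsetSum _ hAI)) h1
    rw [integral_add' (integrable_const _) (integrable_finsetSum _ hAI), integral_const,
      integral_finsetSum _ hAI] at h2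
    simp only [probReal_univ, one_smul] at h2
    simp only [Pi.sub_apply] at h2
    linarith
  have hsum : wignerGibbsFE p v n lam ≤ ∑ X : Fin n → κ, prodWeight p n X *
      ((Real.log L.card + n * B + (n * (lam * ε ^ 2 / 2) + lam * K ^ 4 / 4))
        + ∑ l ∈ L, ∫ z, |∑ i, Real.log
          (scalarZ p v (lam * |ε * l|) (lam * (ε * l) * v (X i)) (z i)) - n * m l|
          ∂stdGaussPi (Fin n)) :=
    Finset.sum_le_sum fun X _ => mul_le_mul_of_nonneg_left (hX X) (prodWeight_nonneg hp n X)
  refine hsum.trans ?_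
  simp only [mul_add (prodWeight p n _) _ (∑ l ∈ L, _), Finset.sum_add_distrib]
  rw [← Finset.sum_mul, sum_prodWeight hp1, one_mul]
  have hlast : ∑ X : Fin n → κ, prodWeight p n X * ∑ l ∈ L, ∫ z, |∑ i, Real.log
          (scalarZ p v (lam * |ε * l|) (lam * (ε * l) * v (X i)) (z i)) - n * m l|
          ∂stdGaussPi (Fin n) ≤ √n * ∑ l ∈ L, √(C l) := by
    simp only [Finset.mul_sum]
    rw [Finset.sum_comm]
    refine Finset.sum_le_sum fun l _ => (hC l n).trans (le_of_eq ?_)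
    rw [Real.sqrt_mul (Nat.cast_nonneg n)]
  have hs : 0 ≤ √(n : ℝ) := Real.sqrt_nonneg _
  nlinarith [mul_nonneg hlog hs, mul_nonneg hK4 hs]

end UpperBound

section GeneralChannel

variable {Ω ι : Type*} [Fintype ι]

lemma abs_channelEnergy_signal_le {A : Ω → ι → ℝ} {b : Ω → ℝ} (hA : ∀ x i, |A x i| ≤ b x)
    (X x : Ω) (z : ι → ℝ) :
    channelEnergy A (fun x => ∑ i, A x i * A X i) x z
        ≤ ∑ i, z i ^ 2 + Fintype.card ι * b X ^ 2 ∧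
      -(∑ i, z i ^ 2 + Fintype.card ι * b X ^ 2) - Fintype.card ι * b x ^ 2
        ≤ channelEnergy A (fun x => ∑ i, A x i * A X i) x z := by
  have hb : ∀ x i, A x i ^ 2 ≤ b x ^ 2 := fun x i =>
    sq_le_sq' (by linarith [neg_abs_le (A x i), hA x i]) ((le_abs_self _).trans (hA x i))
  have e1 : channelEnergy A (fun x => ∑ i, A x i * A X i) x z
      = ∑ i, (A x i * z i - A x i ^ 2 / 2 + A x i * A X i) := by
    rw [channelEnergy, Finset.sum_add_distrib]
  have e2 : ∀ x, (Fintype.card ι : ℝ) * b x ^ 2 = ∑ _i : ι, b x ^ 2 := by simp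
  rw [e1, e2, e2, ← Finset.sum_add_distrib, ← Finset.sum_neg_distrib, ← Finset.sum_sub_distrib]
  constructor
  · refine Finset.sum_le_sum fun i _ => ?_
    nlinarith [hb X i, sq_nonneg (A x i - (z i + A X i)), sq_nonneg (z i - A X i)]
  · refine Finset.sum_le_sum fun i _ => ?_
    nlinarith [hb X i, hb x i, sq_nonneg (A x i + 2 * z i), sq_nonneg (A x i + 2 * A X i)]

variable [MeasurableSpace Ω]

/-- The partition function of the Gaussian channel `x ↦ A x` with prior `μ`, when the
transmitted signal is `A X` and the noise is `z`. -/
def channelPartition (μ : Measure Ω) (A : Ω → ι → ℝ) (X : Ω) (z : ι → ℝ) : ℝ :=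
  ∫ x, Real.exp (channelEnergy A (fun x => ∑ i, A x i * A X i) x z) ∂μ

/-- The free energy of the Gaussian channel `x ↦ A x` with prior `μ`. -/
def channelFE (μ : Measure Ω) (A : Ω → ι → ℝ) : ℝ :=
  ∫ X, ∫ z, Real.log (channelPartition μ A X z) ∂stdGaussPi ι ∂μ

lemma channelFE_comp {κ : Type*} [Fintype κ] [MeasurableSpace κ] [MeasurableSingletonClass κ]
    {μ : Measure Ω} [IsProbabilityMeasure μ] {c : Ω → κ} (hc : Measurable c) (A : κ → ι → ℝ) :
    channelFE μ (fun x => A (c x)) = gibbsFE (fun k => (μ.map c).real {k}) A := by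
  have hprob : IsProbabilityMeasure (μ.map c) := Measure.isProbabilityMeasure_map hc.aemeasurable
  have h : ∀ f : κ → ℝ, ∫ x, f (c x) ∂μ = ∑ k, (μ.map c).real {k} * f k := by
    intro f
    rw [← integral_map hc.aemeasurable (Measurable.of_discrete).aestronglyMeasurable,
      integral_fintype Integrable.of_finite]
    simp
  unfold channelFE gibbsFE
  rw [← h]
  refine integral_congr_ae (ae_of_all _ fun X => integral_congr_ae (ae_of_all _ fun z => ?_))
  simp only [channelPartition, channelZ]
  rw [← h]
  rfl

lemma measurable_channelEnergy_signal {A : Ω → ι → ℝ} (hA : Measurable A) :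
    Measurable fun q : (Ω × (ι → ℝ)) × Ω =>
      channelEnergy A (fun x => ∑ i, A x i * A q.1.1 i) q.2 q.1.2 := by
  have h : ∀ i, Measurable fun x => A x i := fun i => (measurable_pi_apply i).comp hA
  unfold channelEnergy
  refine Measurable.add (Finset.measurable_fun_sum _ fun i _ => ?_)
    (Finset.measurable_fun_sum _ fun i _ => ?_)
  · exact (((h i).comp measurable_snd).mul
      ((measurable_pi_apply i).comp (measurable_snd.comp measurable_fst))).sub
      ((((h i).comp measurable_snd).pow_const 2).div_const 2)
  · exact ((h i).comp measurable_snd).mul ((h i).comp (measurable_fst.comp measurable_fst))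

variable {μ : Measure Ω} [IsProbabilityMeasure μ]

lemma measurable_channelPartition {A : Ω → ι → ℝ} (hA : Measurable A) :
    Measurable fun q : Ω × (ι → ℝ) => channelPartition μ A q.1 q.2 :=
  (StronglyMeasurable.integral_prod_right'
    (Real.measurable_exp.comp (measurable_channelEnergy_signal hA)).stronglyMeasurable).measurable

lemma integrable_exp_channelEnergy_signal {A : Ω → ι → ℝ} (hA : Measurable A) {b : Ω → ℝ}
    (hb : ∀ x i, |A x i| ≤ b x) (X : Ω) (z : ι → ℝ) :
    Integrable (fun x => Real.exp (channelEnergy A (fun x => ∑ i, A x i * A X i) x z)) μ := by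
  have hm : Measurable fun x => Real.exp (channelEnergy A (fun x => ∑ i, A x i * A X i) x z) :=
    Real.measurable_exp.comp ((measurable_channelEnergy_signal hA).comp
      (measurable_prodMk_left (x := (X, z))))
  refine (integrable_const (Real.exp (∑ i, z i ^ 2 + Fintype.card ι * b X ^ 2))).mono'
    hm.aestronglyMeasurable (ae_of_all _ fun x => ?_)
  rw [Real.norm_eq_abs, Real.abs_exp]
  exact Real.exp_le_exp.2 (abs_channelEnergy_signal_le hb X x z).1

lemma channelPartition_pos {A : Ω → ι → ℝ} (hA : Measurable A) {b : Ω → ℝ}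
    (hb : ∀ x i, |A x i| ≤ b x) (X : Ω) (z : ι → ℝ) : 0 < channelPartition μ A X z :=
  integral_exp_pos (integrable_exp_channelEnergy_signal hA hb X z)

lemma exists_abs_log_channelPartition_le {b : Ω → ℝ} (hbm : Measurable b) :
    ∃ D, ∀ A : Ω → ι → ℝ, Measurable A → (∀ x i, |A x i| ≤ b x) → ∀ X z,
      |Real.log (channelPartition μ A X z)|
        ≤ ∑ i, z i ^ 2 + (Fintype.card ι * b X ^ 2 + D) := by
  have hI : Integrable (fun x => Real.exp (-(Fintype.card ι * b x ^ 2))) μ := by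
    refine (integrable_const (1 : ℝ)).mono' ?_ (ae_of_all _ fun x => ?_)
    · exact (Real.measurable_exp.comp ((hbm.pow_const 2).const_mul _).neg).aestronglyMeasurable
    · rw [Real.norm_eq_abs, Real.abs_exp, Real.exp_le_one_iff, neg_nonpos]
      positivity
  set c := ∫ x, Real.exp (-(Fintype.card ι * b x ^ 2)) ∂μ with hc
  have hc0 : 0 < c := integral_exp_pos hI
  have hc1 : c ≤ 1 := by
    refine (integral_mono hI (integrable_const (1 : ℝ)) fun x => ?_).trans (by simp)
    rw [Real.exp_le_one_iff, neg_nonpos]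
    positivity
  refine ⟨-Real.log c, fun A hA hb X z => ?_⟩
  set G := ∑ i, z i ^ 2 + Fintype.card ι * b X ^ 2 with hG
  have hE := integrable_exp_channelEnergy_signal (μ := μ) hA hb X z
  have hpos := channelPartition_pos (μ := μ) hA hb X z
  have hlogc := Real.log_nonpos hc0.le hc1
  have hup : Real.log (channelPartition μ A X z) ≤ G := by
    rw [Real.log_le_iff_le_exp hpos]
    refine (integral_mono hE (integrable_const _) fun x =>
      Real.exp_le_exp.2 (abs_channelEnergy_signal_le hb X x z).1).trans (by simp [hG])
  have hlow : -G + Real.log c ≤ Real.log (channelPartition μ A X z) := by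
    rw [Real.le_log_iff_exp_le hpos, Real.exp_add, Real.exp_log hc0, hc, ← integral_const_mul]
    refine integral_mono (hI.const_mul _) hE fun x => ?_
    simp only [← Real.exp_add]
    refine Real.exp_le_exp.2 ?_
    linarith [(abs_channelEnergy_signal_le hb X x z).2]
  rw [abs_le]
  constructor <;> linarith

lemma integrable_sum_sq_stdGaussPi :
    Integrable (fun z : ι → ℝ => ∑ i, z i ^ 2) (stdGaussPi ι) := by
  refine integrable_finsetSum _ fun i _ => ?_
  refine integrable_comp_eval (μ := fun _ : ι => stdGauss) (f := fun t : ℝ => t ^ 2) (i := i) ?_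
  exact (memLp_id_gaussianReal (μ := 0) (v := 1) 2).integrable_sq

/-- Dominated convergence for the free energy of a Gaussian channel. -/
lemma tendsto_channelFE {A : ℕ → Ω → ι → ℝ} {A' : Ω → ι → ℝ} (hA : ∀ l, Measurable (A l))
    {b : Ω → ℝ} (hbm : Measurable b) (hb2 : Integrable (fun x => b x ^ 2) μ)
    (hb : ∀ l x i, |A l x i| ≤ b x)
    (hlim : ∀ x i, Tendsto (fun l => A l x i) atTop (nhds (A' x i))) :
    Tendsto (fun l => channelFE μ (A l)) atTop (nhds (channelFE μ A')) := by
  have hA' : Measurable A' := measurable_of_tendsto_metrizable hA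
    (tendsto_pi_nhds.2 fun x => tendsto_pi_nhds.2 fun i => hlim x i)
  have hb' : ∀ x i, |A' x i| ≤ b x := fun x i =>
    le_of_tendsto (hlim x i).abs (Eventually.of_forall fun l => hb l x i)
  obtain ⟨D, hD⟩ := exists_abs_log_channelPartition_le (ι := ι) (μ := μ) hbm
  have hP : ∀ X z, Tendsto (fun l => channelPartition μ (A l) X z) atTop
      (nhds (channelPartition μ A' X z)) := by
    intro X z
    refine tendsto_integral_of_dominated_convergence
      (fun _ => Real.exp (∑ i, z i ^ 2 + Fintype.card ι * b X ^ 2))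
      (fun l => (integrable_exp_channelEnergy_signal (hA l) (hb l) X z).aestronglyMeasurable)
      (integrable_const _) (fun l => ae_of_all _ fun x => ?_) (ae_of_all _ fun x => ?_)
    · rw [Real.norm_eq_abs, Real.abs_exp]
      exact Real.exp_le_exp.2 (abs_channelEnergy_signal_le (hb l) X x z).1
    · refine (Real.continuous_exp.tendsto _).comp ?_
      unfold channelEnergy
      refine Tendsto.add (tendsto_finsetSum _ fun i _ => ?_) (tendsto_finsetSum _ fun i _ => ?_)
      · exact ((hlim x i).mul_const _).sub (((hlim x i).pow 2).div_const _)
      · exact (hlim x i).mul (hlim X i)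
  have hmeas : ∀ l, Measurable fun q : Ω × (ι → ℝ) =>
      Real.log (channelPartition μ (A l) q.1 q.2) := fun l =>
    Real.measurable_log.comp (measurable_channelPartition (hA l))
  have hz := integrable_sum_sq_stdGaussPi (ι := ι)
  have hGI : ∀ X, Integrable (fun z : ι → ℝ =>
      ∑ i, z i ^ 2 + (Fintype.card ι * b X ^ 2 + D)) (stdGaussPi ι) := fun X =>
    hz.add (integrable_const _)
  refine tendsto_integral_of_dominated_convergence
    (fun X => (∫ z : ι → ℝ, ∑ i, z i ^ 2 ∂stdGaussPi ι) + (Fintype.card ι * b X ^ 2 + D))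
    (fun l => ?_) ?_ (fun l => ae_of_all _ fun X => ?_) (ae_of_all _ fun X => ?_)
  · exact (hmeas l).stronglyMeasurable.integral_prod_right'.aestronglyMeasurable
  · exact (integrable_const _).add ((hb2.const_mul _).add (integrable_const _))
  · refine (norm_integral_le_of_norm_le (hGI X) (ae_of_all _ fun z => ?_)).trans (le_of_eq ?_)
    · exact hD (A l) (hA l) (hb l) X z
    · rw [integral_add hz (integrable_const _)]
      simp
  · refine tendsto_integral_of_dominated_convergence _ (fun l => ?_) (hGI X)
      (fun l => ae_of_all _ fun z => hD (A l) (hA l) (hb l) X z) (ae_of_all _ fun z => ?_)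
    · exact ((hmeas l).comp (measurable_prodMk_left (x := X))).aestronglyMeasurable
    · exact (hP X z).log (channelPartition_pos hA' hb' X z).ne'

end GeneralChannel

section Stability

variable {Ω ι : Type*} [Fintype ι]

/-- The cost, with trade-off parameter `η`, of replacing the signal `a` by `b`. -/
def signalCost (η : ℝ) (a b : ι → ℝ) : ℝ :=
  ∑ i, (η * (a i ^ 2 + b i ^ 2) + (a i - b i) ^ 2 / η) / 2

lemma signalCost_comm (η : ℝ) (a b : ι → ℝ) : signalCost η a b = signalCost η b a :=
  Finset.sum_congr rfl fun i _ => by ring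

lemma sum_mul_sub_sum_mul_le {η : ℝ} (hη : 0 < η) (a b a' b' : ι → ℝ) :
    ∑ i, a i * a' i - ∑ i, b i * b' i ≤ signalCost η a b + signalCost η a' b' := by
  rw [signalCost, signalCost, ← Finset.sum_sub_distrib, ← Finset.sum_add_distrib]
  refine Finset.sum_le_sum fun i _ => ?_
  have h : ∀ s t : ℝ, s * t ≤ (η * s ^ 2 + t ^ 2 / η) / 2 := by
    intro s t
    have h1 : (η * s ^ 2 + t ^ 2 / η) / 2 - s * t = (η * s - t) ^ 2 / (2 * η) := by
      field_simp
      ring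
    have h2 : 0 ≤ (η * s - t) ^ 2 / (2 * η) := by positivity
    linarith
  have h1 := h (a i) (a' i - b' i)
  have h2 := h (b' i) (a i - b i)
  have h3 : 0 ≤ η * b i ^ 2 := by positivity
  have h4 : 0 ≤ η * a' i ^ 2 := by positivity
  linarith

variable [MeasurableSpace Ω] {μ : Measure Ω} [IsProbabilityMeasure μ]

lemma channelFE_comp_le {κ : Type*} [Fintype κ] [MeasurableSpace κ] [MeasurableSingletonClass κ]
    {c : Ω → κ} (hc : Measurable c) (a b : κ → ι → ℝ) {η : ℝ} (hη : 0 < η) :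
    channelFE μ (fun x => a (c x)) ≤ channelFE μ (fun x => b (c x))
      + ∫ x, signalCost η (a (c x)) (b (c x)) ∂μ := by
  have hprob : IsProbabilityMeasure (μ.map c) := Measure.isProbabilityMeasure_map hc.aemeasurable
  have h := gibbsFE_le (w := fun k => (μ.map c).real {k}) (fun k => measureReal_nonneg)
    (by simp) a b (fun k => signalCost η (a k) (b k)) fun x y => sum_mul_sub_sum_mul_le hη _ _ _ _
  rw [channelFE_comp hc, channelFE_comp hc]
  refine h.trans (le_of_eq ?_)
  rw [← integral_map (f := fun k => signalCost η (a k) (b k)) hc.aemeasurable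
    (Measurable.of_discrete).aestronglyMeasurable, integral_fintype Integrable.of_finite]
  simp

/-- Stability of the free energy of a Gaussian channel under perturbation of the signal. -/
lemma channelFE_le_add {A B : Ω → ι → ℝ} (hA : Measurable A) (hB : Measurable B)
    (hA2 : ∀ i, MemLp (fun x => A x i) 2 μ) (hB2 : ∀ i, MemLp (fun x => B x i) 2 μ) {η : ℝ}
    (hη : 0 < η) :
    channelFE μ A ≤ channelFE μ B + ∫ x, signalCost η (A x) (B x) ∂μ := by
  have hF : Measurable fun x => (A x, B x) := hA.prodMk hB
  set T : ℕ → SimpleFunc Ω ((ι → ℝ) × (ι → ℝ)) := fun l =>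
    SimpleFunc.approxOn (fun x => (A x, B x)) hF Set.univ 0 (Set.mem_univ _) l with hT
  set b : Ω → ℝ := fun x => 2 * ∑ i, (|A x i| + |B x i|) with hbdef
  have hmA : ∀ i, Measurable fun x => A x i := fun i => (measurable_pi_apply i).comp hA
  have hmB : ∀ i, Measurable fun x => B x i := fun i => (measurable_pi_apply i).comp hB
  have hbm : Measurable b :=
    (Finset.measurable_fun_sum _ fun i _ => (hmA i).abs.add (hmB i).abs).const_mul 2
  have hb0 : ∀ x, 0 ≤ b x := fun x =>
    mul_nonneg two_pos.le (Finset.sum_nonneg fun i _ => add_nonneg (abs_nonneg _) (abs_nonneg _))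
  have hb2 : Integrable (fun x => b x ^ 2) μ := by
    have : MemLp b 2 μ := by
      refine MemLp.const_mul (c := (2 : ℝ)) (f := fun x => ∑ i, (|A x i| + |B x i|)) ?_
      exact memLp_finsetSum _ fun i _ => (hA2 i).abs.add (hB2 i).abs
    exact this.integrable_sq
  have hTb : ∀ l x, ‖T l x‖ ≤ b x := by
    intro l x
    have hsum : ∀ u : ι → ℝ, ‖u‖ ≤ ∑ i, |u i| := fun u =>
      (pi_norm_le_iff_of_nonneg (Finset.sum_nonneg fun i _ => abs_nonneg _)).2 fun i =>
        Finset.single_le_sum (f := fun i => |u i|) (fun _ _ => abs_nonneg _) (Finset.mem_univ i)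
    have h1 := SimpleFunc.norm_approxOn_zero_le hF (Set.mem_univ _) x l
    have h2 : ‖(A x, B x)‖ ≤ ∑ i, (|A x i| + |B x i|) := by
      rw [Finset.sum_add_distrib]
      refine (max_le_add_of_nonneg (norm_nonneg _) (norm_nonneg _)).trans
        (add_le_add (hsum _) (hsum _))
    simp only [hbdef]
    linarith
  have hTlim : ∀ x, Tendsto (fun l => T l x) atTop (nhds (A x, B x)) := fun x =>
    SimpleFunc.tendsto_approxOn hF (Set.mem_univ _) (by simp)
  have h1b : ∀ l x i, |(T l x).1 i| ≤ b x := fun l x i =>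
    (norm_le_pi_norm (T l x).1 i).trans ((norm_fst_le _).trans (hTb l x))
  have h2b : ∀ l x i, |(T l x).2 i| ≤ b x := fun l x i =>
    (norm_le_pi_norm (T l x).2 i).trans ((norm_snd_le _).trans (hTb l x))
  have h1lim : ∀ x i, Tendsto (fun l => (T l x).1 i) atTop (nhds (A x i)) := fun x i =>
    tendsto_pi_nhds.1 ((continuous_fst.tendsto _).comp (hTlim x)) i
  have h2lim : ∀ x i, Tendsto (fun l => (T l x).2 i) atTop (nhds (B x i)) := fun x i =>
    tendsto_pi_nhds.1 ((continuous_snd.tendsto _).comp (hTlim x)) i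
  have hm1 : ∀ l, Measurable fun x => (T l x).1 := fun l => measurable_fst.comp (T l).measurable
  have hm2 : ∀ l, Measurable fun x => (T l x).2 := fun l => measurable_snd.comp (T l).measurable
  have key : ∀ l, channelFE μ (fun x => (T l x).1) ≤ channelFE μ (fun x => (T l x).2)
      + ∫ x, signalCost η (T l x).1 (T l x).2 ∂μ := by
    intro l
    have hc : Measurable fun x => (⟨T l x, (T l).mem_range_self x⟩ : (T l).range) :=
      (T l).measurable.subtype_mk
    exact channelFE_comp_le hc (fun k => k.1.1) (fun k => k.1.2) hη
  have hcost : Tendsto (fun l => ∫ x, signalCost η (T l x).1 (T l x).2 ∂μ) atTop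
      (nhds (∫ x, signalCost η (A x) (B x) ∂μ)) := by
    refine tendsto_integral_of_dominated_convergence
      (fun x => (Fintype.card ι * (η + 2 / η)) * b x ^ 2) (fun l => ?_) (hb2.const_mul _)
      (fun l => ae_of_all _ fun x => ?_) (ae_of_all _ fun x => ?_)
    · refine Measurable.aestronglyMeasurable ?_
      unfold signalCost
      refine Finset.measurable_fun_sum _ fun i _ => ?_
      have e1 : Measurable fun x => (T l x).1 i := (measurable_pi_apply i).comp (hm1 l)
      have e2 : Measurable fun x => (T l x).2 i := (measurable_pi_apply i).comp (hm2 l)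
      fun_prop
    · have hnn : 0 ≤ signalCost η (T l x).1 (T l x).2 :=
        Finset.sum_nonneg fun i _ => by positivity
      rw [Real.norm_eq_abs, abs_of_nonneg hnn, signalCost]
      refine (Finset.sum_le_sum (g := fun _ => (η + 2 / η) * b x ^ 2) fun i _ => ?_).trans
        (le_of_eq (by simp; ring))
      have e1 : (T l x).1 i ^ 2 ≤ b x ^ 2 := sq_le_sq.2 ((h1b l x i).trans (le_abs_self _))
      have e2 : (T l x).2 i ^ 2 ≤ b x ^ 2 := sq_le_sq.2 ((h2b l x i).trans (le_abs_self _))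
      have e3 : ((T l x).1 i - (T l x).2 i) ^ 2 / η ≤ 4 * b x ^ 2 / η := by
        refine div_le_div_of_nonneg_right ?_ hη.le
        nlinarith [sq_nonneg ((T l x).1 i + (T l x).2 i)]
      have e4 : 4 * b x ^ 2 / η = 2 * (2 / η * b x ^ 2) := by ring
      nlinarith
    · refine tendsto_finsetSum _ fun i _ => ?_
      have e1 := h1lim x i
      have e2 := h2lim x i
      exact ((((e1.pow 2).add (e2.pow 2)).const_mul η).add
        (((e1.sub e2).pow 2).div_const η)).div_const 2
  exact le_of_tendsto_of_tendsto' (tendsto_channelFE hm1 hbm hb2 h1b h1lim)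
    ((tendsto_channelFE hm2 hbm hb2 h2b h2lim).add hcost) key

/-- Stability of the free energy of a Gaussian channel under perturbation of the signal. -/
lemma abs_channelFE_sub_le {A B : Ω → ι → ℝ} (hA : Measurable A) (hB : Measurable B)
    (hA2 : ∀ i, MemLp (fun x => A x i) 2 μ) (hB2 : ∀ i, MemLp (fun x => B x i) 2 μ) {η : ℝ}
    (hη : 0 < η) :
    |channelFE μ A - channelFE μ B| ≤ ∫ x, signalCost η (A x) (B x) ∂μ := by
  have h1 := channelFE_le_add hA hB hA2 hB2 hη
  have h2 := channelFE_le_add hB hA hB2 hA2 hη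
  simp only [signalCost_comm η (B _)] at h2
  rw [abs_le]
  constructor <;> linarith

end Stability

section Identification

variable {P0 : Measure ℝ}

lemma hamiltonian_eq_channelEnergy {n : ℕ} {lam : ℝ} (hlam : 0 ≤ lam) (X x : Fin n → ℝ)
    (z : Fin n × Fin n → ℝ) :
    hamiltonian n lam X z x = channelEnergy (wignerSignal n lam)
      (fun x => ∑ e, wignerSignal n lam x e * wignerSignal n lam X e) x z := by
  rw [channelEnergy, ← Finset.sum_add_distrib, hamiltonian, pairs, Finset.sum_filter]
  refine Finset.sum_congr rfl fun e _ => ?_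
  unfold wignerSignal
  split_ifs
  · have h : √(lam / n) * √(lam / n) = lam / n := Real.mul_self_sqrt (by positivity)
    have h2 : lam / (2 * n) = lam / n / 2 := by rw [mul_comm, div_div]
    rw [h2]
    generalize lam / n = t at *
    generalize √t = s at *
    subst h
    ring
  · simp

lemma freeEnergy_eq_channelFE {n : ℕ} {lam : ℝ} (hlam : 0 ≤ lam) :
    freeEnergy P0 n lam
      = 1 / n * channelFE (Measure.pi fun _ : Fin n => P0) (wignerSignal n lam) := by
  simp only [freeEnergy, channelFE, channelPartition, hamiltonian_eq_channelEnergy hlam]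

lemma scalarFE_eq_channelFE {γ : ℝ} (hγ : 0 ≤ γ) :
    scalarFE P0 γ = channelFE P0 fun x (_ : Unit) => √γ * x := by
  unfold scalarFE channelFE channelPartition
  refine integral_congr_ae (ae_of_all _ fun X => ?_)
  simp only
  rw [← integral_comp_unit]
  refine integral_congr_ae (ae_of_all _ fun z => ?_)
  simp only [channelEnergy, Fintype.sum_unique]
  congr 2
  funext x
  congr 1
  have h : √γ * √γ = γ := Real.mul_self_sqrt hγ
  have h2 : (√γ * x) ^ 2 / 2 = γ / 2 * x ^ 2 := by rw [mul_pow, sq √γ, h]; ring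
  have h3 : √γ * x * (√γ * X) = γ * x * X := by
    calc √γ * x * (√γ * X) = √γ * √γ * x * X := by ring
      _ = γ * x * X := by rw [h]
  simp only [PUnit.default_eq_unit] at *
  rw [h2, h3]
  ring

lemma integral_signalCost_scalar {T : ℝ → ℝ} (hmom : Integrable (fun x => x ^ 2) P0)
    (hT2 : Integrable (fun x => T x ^ 2) P0) (hTd : Integrable (fun x => (x - T x) ^ 2) P0)
    {γ : ℝ} (hγ : 0 ≤ γ) (η : ℝ) :
    ∫ x, signalCost η (fun _ : Unit => √γ * x) (fun _ : Unit => √γ * T x) ∂P0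
      = γ / 2 * (η * ((∫ x, x ^ 2 ∂P0) + ∫ x, T x ^ 2 ∂P0)
        + (∫ x, (x - T x) ^ 2 ∂P0) / η) := by
  have h : ∀ x, signalCost η (fun _ : Unit => √γ * x) (fun _ : Unit => √γ * T x)
      = γ / 2 * (η * (x ^ 2 + T x ^ 2) + (x - T x) ^ 2 / η) := by
    intro x
    rw [signalCost, Fintype.sum_unique, ← mul_sub, mul_pow, mul_pow, mul_pow, Real.sq_sqrt hγ]
    ring
  simp only [h]
  rw [integral_const_mul, integral_add ((hmom.fun_add hT2).const_mul η) (hTd.div_const η),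
    integral_const_mul, integral_add hmom hT2, integral_div]

variable [IsProbabilityMeasure P0]

/-- The probability weights of a simple function on its range. -/
def simpleWeight (P0 : Measure ℝ) (T : SimpleFunc ℝ ℝ) (k : T.range) : ℝ :=
  (P0.map fun x => (⟨T x, T.mem_range_self x⟩ : T.range)).real {k}

lemma measurable_toRange (T : SimpleFunc ℝ ℝ) :
    Measurable fun x => (⟨T x, T.mem_range_self x⟩ : T.range) :=
  T.measurable.subtype_mk

lemma channelFE_simple_scalar (T : SimpleFunc ℝ ℝ) (γ : ℝ) :
    channelFE P0 (fun x (_ : Unit) => √γ * T x)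
      = scalarGibbsFE (simpleWeight P0 T) Subtype.val γ :=
  channelFE_comp (measurable_toRange T) fun (k : T.range) (_ : Unit) => √γ * k.1

lemma channelFE_simple_wigner (T : SimpleFunc ℝ ℝ) (n : ℕ) (lam : ℝ) :
    channelFE (Measure.pi fun _ : Fin n => P0) (fun x => wignerSignal n lam fun i => T (x i))
      = wignerGibbsFE (simpleWeight P0 T) Subtype.val n lam := by
  have hc := measurable_toRange T
  have hprob : IsProbabilityMeasure (P0.map fun x => (⟨T x, T.mem_range_self x⟩ : T.range)) :=
    Measure.isProbabilityMeasure_map hc.aemeasurable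
  have hC : Measurable fun (x : Fin n → ℝ) (i : Fin n) =>
      (⟨T (x i), T.mem_range_self (x i)⟩ : T.range) :=
    measurable_pi_lambda _ fun i => hc.comp (measurable_pi_apply i)
  have h := channelFE_comp (μ := Measure.pi fun _ : Fin n => P0) hC
    fun σ : Fin n → T.range => wignerSignal n lam fun i => (σ i).1
  refine h.trans ?_
  unfold wignerGibbsFE
  congr 1
  funext σ
  have hmap := Measure.pi_map_pi (μ := fun _ : Fin n => P0)
    (f := fun _ x => (⟨T x, T.mem_range_self x⟩ : T.range)) fun _ => hc.aemeasurable
  rw [hmap, prodWeight, measureReal_def, Measure.pi_singleton, ENNReal.toReal_prod]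
  rfl

end Identification

section SecondMoment

variable {n : ℕ} {P0 : Measure ℝ} [IsProbabilityMeasure P0]

lemma integral_pi_mul {f g : ℝ → ℝ} (hf : Integrable f P0) (hg : Integrable g P0) {i j : Fin n}
    (hij : i ≠ j) :
    Integrable (fun x : Fin n → ℝ => f (x i) * g (x j)) (Measure.pi fun _ : Fin n => P0) ∧
      ∫ x : Fin n → ℝ, f (x i) * g (x j) ∂(Measure.pi fun _ : Fin n => P0)
        = (∫ t, f t ∂P0) * ∫ t, g t ∂P0 := by
  have hind : IndepFun (fun x : Fin n → ℝ => f (x i)) (fun x : Fin n → ℝ => g (x j))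
      (Measure.pi fun _ : Fin n => P0) := by
    have h := iIndepFun_pi (μ := fun _ : Fin n => P0)
      (X := fun k => if k = i then f else g) (fun k => by
        split_ifs
        · exact hf.aestronglyMeasurable.aemeasurable
        · exact hg.aestronglyMeasurable.aemeasurable)
    have h2 := h.indepFun hij
    simpa [hij.symm] using h2
  have hfi : Integrable (fun x : Fin n → ℝ => f (x i)) (Measure.pi fun _ : Fin n => P0) :=
    integrable_comp_eval (μ := fun _ : Fin n => P0) hf
  have hgj : Integrable (fun x : Fin n → ℝ => g (x j)) (Measure.pi fun _ : Fin n => P0) :=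
    integrable_comp_eval (μ := fun _ : Fin n => P0) hg
  refine ⟨hind.integrable_mul hfi hgj, ?_⟩
  rw [hind.integral_fun_mul_eq_mul_integral hfi.aestronglyMeasurable hgj.aestronglyMeasurable,
    integral_comp_eval hf.aestronglyMeasurable, integral_comp_eval hg.aestronglyMeasurable]

lemma measurable_wignerSignal {T : ℝ → ℝ} (hT : Measurable T) (lam : ℝ) :
    Measurable fun x : Fin n → ℝ => wignerSignal n lam fun i => T (x i) := by
  refine measurable_pi_lambda _ fun e => ?_
  unfold wignerSignal
  split_ifs
  · exact ((hT.comp (measurable_pi_apply _)).const_mul _).mul (hT.comp (measurable_pi_apply _))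
  · exact measurable_const

lemma memLp_wignerSignal {T : ℝ → ℝ} (hT : Measurable T) (hT2 : Integrable (fun x => T x ^ 2) P0)
    (lam : ℝ) (e : Fin n × Fin n) :
    MemLp (fun x : Fin n → ℝ => wignerSignal n lam (fun i => T (x i)) e) 2
      (Measure.pi fun _ : Fin n => P0) := by
  have hm : Measurable fun x : Fin n → ℝ => wignerSignal n lam (fun i => T (x i)) e :=
    (measurable_pi_apply e).comp (measurable_wignerSignal hT lam)
  rw [memLp_two_iff_integrable_sq hm.aestronglyMeasurable]
  unfold wignerSignal
  split_ifs with he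
  · refine ((integral_pi_mul hT2 hT2 he.ne).1.const_mul (√(lam / n) ^ 2)).congr
      (ae_of_all _ fun x => ?_)
    ring
  · simp

lemma integral_signalCost_wigner_le {T : ℝ → ℝ} (hmom : Integrable (fun x => x ^ 2) P0)
    (hT2 : Integrable (fun x => T x ^ 2) P0) (hTd : Integrable (fun x => (x - T x) ^ 2) P0)
    {lam : ℝ} (hlam : 0 ≤ lam) {η : ℝ} (hη : 0 < η) (hn : 0 < n) :
    ∫ x, signalCost η (wignerSignal n lam x) (wignerSignal n lam fun i => T (x i))
        ∂(Measure.pi fun _ : Fin n => P0)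
      ≤ n * (lam / 2 * (η * ((∫ x, x ^ 2 ∂P0) ^ 2 + (∫ x, T x ^ 2 ∂P0) ^ 2)
        + 2 * ((∫ x, x ^ 2 ∂P0) + ∫ x, T x ^ 2 ∂P0) * (∫ x, (x - T x) ^ 2 ∂P0) / η)) := by
  set ρ := ∫ x, x ^ 2 ∂P0 with hρ
  set τ := ∫ x, T x ^ 2 ∂P0 with hτ
  set δ := ∫ x, (x - T x) ^ 2 ∂P0 with hδ
  have hn' : (0 : ℝ) < n := by exact_mod_cast hn
  have hρ0 : 0 ≤ ρ := integral_nonneg fun _ => sq_nonneg _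
  have hτ0 : 0 ≤ τ := integral_nonneg fun _ => sq_nonneg _
  have hδ0 : 0 ≤ δ := integral_nonneg fun _ => sq_nonneg _
  set F : Fin n × Fin n → (Fin n → ℝ) → ℝ := fun e x => if e.1 < e.2 then
    lam / n / 2 * (η * (x e.1 ^ 2 * x e.2 ^ 2 + T (x e.1) ^ 2 * T (x e.2) ^ 2)
      + 2 / η * (x e.1 ^ 2 * (x e.2 - T (x e.2)) ^ 2 + (x e.1 - T (x e.1)) ^ 2 * T (x e.2) ^ 2))
    else 0 with hF
  set M := lam / n / 2 * (η * (ρ ^ 2 + τ ^ 2) + 2 / η * (ρ * δ + δ * τ)) with hM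
  have hM0 : 0 ≤ M := by positivity
  have hFI : ∀ e, Integrable (F e) (Measure.pi fun _ : Fin n => P0) ∧
      ∫ x, F e x ∂(Measure.pi fun _ : Fin n => P0) ≤ M := by
    intro e
    simp only [hF]
    split_ifs with he
    · obtain ⟨i1, e1⟩ := integral_pi_mul hmom hmom he.ne
      obtain ⟨i2, e2⟩ := integral_pi_mul hT2 hT2 he.ne
      obtain ⟨i3, e3⟩ := integral_pi_mul hmom hTd he.ne
      obtain ⟨i4, e4⟩ := integral_pi_mul hTd hT2 he.ne
      have j1 := (i1.fun_add i2).const_mul η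
      have j2 := (i3.fun_add i4).const_mul (2 / η)
      refine ⟨(j1.fun_add j2).const_mul _, le_of_eq ?_⟩
      rw [integral_const_mul, integral_add j1 j2, integral_const_mul, integral_const_mul,
        integral_add i1 i2, integral_add i3 i4, e1, e2, e3, e4, hM]
      ring
    · simpa using hM0
  have hle : ∀ x : Fin n → ℝ, signalCost η (wignerSignal n lam x)
      (wignerSignal n lam fun i => T (x i)) ≤ ∑ e, F e x := by
    intro x
    refine Finset.sum_le_sum fun e _ => ?_
    simp only [wignerSignal, hF]
    split_ifs
    · have hs : √(lam / n) ^ 2 = lam / n := Real.sq_sqrt (by positivity)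
      generalize lam / n = t at *
      generalize √t = s at *
      subst hs
      generalize x e.1 = a
      generalize x e.2 = b
      have h4 : (a * b - T a * T b) ^ 2
          ≤ 2 * (a ^ 2 * (b - T b) ^ 2 + (a - T a) ^ 2 * T b ^ 2) := by
        nlinarith [sq_nonneg (a * (b - T b) - (a - T a) * T b)]
      have h5 := mul_le_mul_of_nonneg_left h4 (show 0 ≤ s ^ 2 / 2 / η by positivity)
      have h6 : s ^ 2 / 2 * (η * (a ^ 2 * b ^ 2 + T a ^ 2 * T b ^ 2)
            + 2 / η * (a ^ 2 * (b - T b) ^ 2 + (a - T a) ^ 2 * T b ^ 2))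
          - (η * ((s * a * b) ^ 2 + (s * T a * T b) ^ 2)
            + (s * a * b - s * T a * T b) ^ 2 / η) / 2
          = s ^ 2 / 2 / η * (2 * (a ^ 2 * (b - T b) ^ 2 + (a - T a) ^ 2 * T b ^ 2))
            - s ^ 2 / 2 / η * (a * b - T a * T b) ^ 2 := by
        ring
      linarith
    · simp
  refine (integral_mono_of_nonneg (ae_of_all _ fun x => Finset.sum_nonneg fun i _ => by positivity)
    (integrable_finsetSum _ fun e _ => (hFI e).1) (ae_of_all _ hle)).trans ?_
  rw [integral_finsetSum _ fun e _ => (hFI e).1]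
  refine (Finset.sum_le_card_nsmul _ _ _ fun e _ => (hFI e).2).trans (le_of_eq ?_)
  rw [Finset.card_univ, Fintype.card_prod, Fintype.card_fin, nsmul_eq_mul, hM]
  push_cast
  field_simp

end SecondMoment

section Approximation

variable {P0 : Measure ℝ}

lemma simpleWeight_nonneg (T : SimpleFunc ℝ ℝ) (k : T.range) : 0 ≤ simpleWeight P0 T k :=
  measureReal_nonneg

variable [IsProbabilityMeasure P0]

lemma sum_simpleWeight (T : SimpleFunc ℝ ℝ) : ∑ k, simpleWeight P0 T k = 1 := by
  have := Measure.isProbabilityMeasure_map (μ := P0) (measurable_toRange T).aemeasurable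
  simp [simpleWeight]

lemma abs_freeEnergy_sub_le {T : SimpleFunc ℝ ℝ} (hmom : Integrable (fun x => x ^ 2) P0)
    (hT2 : Integrable (fun x => T x ^ 2) P0) (hTd : Integrable (fun x => (x - T x) ^ 2) P0)
    {lam : ℝ} (hlam : 0 ≤ lam) {η : ℝ} (hη : 0 < η) {n : ℕ} (hn : 0 < n) :
    |freeEnergy P0 n lam - 1 / n * wignerGibbsFE (simpleWeight P0 T) Subtype.val n lam|
      ≤ lam / 2 * (η * ((∫ x, x ^ 2 ∂P0) ^ 2 + (∫ x, T x ^ 2 ∂P0) ^ 2)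
        + 2 * ((∫ x, x ^ 2 ∂P0) + ∫ x, T x ^ 2 ∂P0) * (∫ x, (x - T x) ^ 2 ∂P0) / η) := by
  have hn' : (0 : ℝ) < n := by exact_mod_cast hn
  rw [freeEnergy_eq_channelFE hlam, ← channelFE_simple_wigner, ← mul_sub, abs_mul,
    abs_of_pos (by positivity), one_div, inv_mul_le_iff₀ hn']
  exact (abs_channelFE_sub_le (measurable_wignerSignal measurable_id lam)
    (measurable_wignerSignal T.measurable lam) (memLp_wignerSignal measurable_id hmom lam)
    (memLp_wignerSignal T.measurable hT2 lam) hη).trans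
    (integral_signalCost_wigner_le hmom hT2 hTd hlam hη hn)

lemma abs_scalar_channelFE_sub_le {T : ℝ → ℝ} (hT : Measurable T)
    (hmom : Integrable (fun x => x ^ 2) P0)
    (hT2 : Integrable (fun x => T x ^ 2) P0) (hTd : Integrable (fun x => (x - T x) ^ 2) P0)
    {γ : ℝ} (hγ : 0 ≤ γ) {η : ℝ} (hη : 0 < η) :
    |scalarFE P0 γ - channelFE P0 fun x (_ : Unit) => √γ * T x|
      ≤ γ / 2 * (η * ((∫ x, x ^ 2 ∂P0) + ∫ x, T x ^ 2 ∂P0)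
        + (∫ x, (x - T x) ^ 2 ∂P0) / η) := by
  rw [scalarFE_eq_channelFE hγ, ← integral_signalCost_scalar hmom hT2 hTd hγ]
  refine abs_channelFE_sub_le (measurable_pi_lambda _ fun _ => measurable_id.const_mul _)
    (measurable_pi_lambda _ fun _ => hT.const_mul _) (fun _ => ?_) (fun _ => ?_) hη
  · exact MemLp.const_mul
      ((memLp_two_iff_integrable_sq measurable_id.aestronglyMeasurable).2 hmom) _
  · exact MemLp.const_mul ((memLp_two_iff_integrable_sq hT.aestronglyMeasurable).2 hT2) _

/-- Approximation of the prior by finitely supported priors, uniformly in the dimension. -/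
lemma exists_simpleFunc_approx (hmom : Integrable (fun x => x ^ 2) P0) {lam : ℝ} (hlam : 0 ≤ lam)
    {ε : ℝ} (hε : 0 < ε) :
    ∃ T : SimpleFunc ℝ ℝ,
      (∀ n : ℕ, 0 < n → |freeEnergy P0 n lam
        - 1 / n * wignerGibbsFE (simpleWeight P0 T) Subtype.val n lam| ≤ ε) ∧
      ∀ γ, 0 ≤ γ → |scalarFE P0 γ - scalarGibbsFE (simpleWeight P0 T) Subtype.val γ| ≤ γ * ε := by
  set T : ℕ → SimpleFunc ℝ ℝ := fun l =>
    SimpleFunc.approxOn (fun x : ℝ => x) measurable_id Set.univ 0 (Set.mem_univ _) l with hT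
  have hTlim : ∀ x, Tendsto (fun l => T l x) atTop (nhds x) := fun x =>
    SimpleFunc.tendsto_approxOn measurable_id (Set.mem_univ _) (by simp)
  have hTb : ∀ l x, |T l x| ≤ 2 * |x| := fun l x => by
    have h : ‖T l x‖ ≤ ‖x‖ + ‖x‖ :=
      SimpleFunc.norm_approxOn_zero_le measurable_id (Set.mem_univ _) x l
    rw [Real.norm_eq_abs, Real.norm_eq_abs] at h
    linarith
  have hsq : ∀ l x, T l x ^ 2 ≤ 4 * x ^ 2 := fun l x => by
    have := pow_le_pow_left₀ (abs_nonneg _) (hTb l x) 2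
    rw [mul_pow, sq_abs, sq_abs] at this
    linarith
  have hdq : ∀ l x, (x - T l x) ^ 2 ≤ 10 * x ^ 2 := fun l x => by
    nlinarith [hsq l x, sq_nonneg (x + T l x)]
  have hTm : ∀ l, Measurable (T l) := fun l => (T l).measurable
  have hT2 : ∀ l, Integrable (fun x => T l x ^ 2) P0 := fun l =>
    (hmom.const_mul 4).mono' ((hTm l).pow_const 2).aestronglyMeasurable
      (ae_of_all _ fun x => by
        rw [Real.norm_eq_abs, abs_of_nonneg (sq_nonneg _)]
        exact hsq l x)
  have hdm : ∀ l, Measurable fun x => (x - T l x) ^ 2 := fun l =>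
    (measurable_id.sub (hTm l)).pow_const 2
  have hdn : ∀ l x, ‖(x - T l x) ^ 2‖ ≤ 10 * x ^ 2 := fun l x => by
    rw [Real.norm_eq_abs, abs_of_nonneg (sq_nonneg _)]
    exact hdq l x
  have hTd : ∀ l, Integrable (fun x => (x - T l x) ^ 2) P0 := fun l =>
    (hmom.const_mul 10).mono' (hdm l).aestronglyMeasurable (ae_of_all _ (hdn l))
  have hδ : Tendsto (fun l => ∫ x, (x - T l x) ^ 2 ∂P0) atTop (nhds 0) := by
    have h := tendsto_integral_of_dominated_convergence (μ := P0) (f := fun _ => (0 : ℝ))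
      (fun x => 10 * x ^ 2) (fun l => (hdm l).aestronglyMeasurable) (hmom.const_mul 10)
      (fun l => ae_of_all _ (hdn l)) (ae_of_all _ fun x => by
        have h1 : Tendsto (fun l => (x - T l x) ^ 2) atTop (nhds ((x - x) ^ 2)) :=
          (tendsto_const_nhds.sub (hTlim x)).pow 2
        simpa using h1)
    simpa using h
  set ρ := ∫ x, x ^ 2 ∂P0 with hρ
  have hρ0 : 0 ≤ ρ := integral_nonneg fun _ => sq_nonneg _
  have hτ : ∀ l, ∫ x, T l x ^ 2 ∂P0 ≤ 4 * ρ := fun l => by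
    rw [hρ, ← integral_const_mul]
    exact integral_mono (hT2 l) (hmom.const_mul 4) (hsq l)
  set C := lam * (17 * ρ ^ 2 + 10 * ρ) + 5 * ρ + 1 with hC
  have hC0 : 0 < C := by positivity
  set η := ε / C with hη
  have hη0 : 0 < η := by positivity
  have hηC : η * C = ε := by rw [hη]; field_simp
  obtain ⟨l, hl⟩ := ((tendsto_order.1 hδ).2 (η ^ 2) (by positivity)).exists
  have hδ0 : 0 ≤ ∫ x, (x - T l x) ^ 2 ∂P0 := integral_nonneg fun _ => sq_nonneg _
  have hτ0 : 0 ≤ ∫ x, T l x ^ 2 ∂P0 := integral_nonneg fun _ => sq_nonneg _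
  have h1 := fun (n : ℕ) (hn : 0 < n) =>
    abs_freeEnergy_sub_le hmom (hT2 l) (hTd l) hlam hη0 hn
  have h2 := fun (γ : ℝ) (hγ : 0 ≤ γ) =>
    abs_scalar_channelFE_sub_le (hTm l) hmom (hT2 l) (hTd l) hγ hη0
  have hτl := hτ l
  simp only [← hρ] at h1 h2
  generalize ∫ x, (x - T l x) ^ 2 ∂P0 = δ at *
  generalize ∫ x, T l x ^ 2 ∂P0 = τ at *
  have hδη : δ / η ≤ η := by
    rw [div_le_iff₀ hη0, ← sq]
    exact hl.le
  have hδη0 : 0 ≤ δ / η := by positivity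
  refine ⟨T l, fun n hn => (h1 n hn).trans ?_, fun γ hγ => ?_⟩
  · have e1 : τ ^ 2 ≤ (4 * ρ) ^ 2 := pow_le_pow_left₀ hτ0 hτl 2
    have e2 : 2 * (ρ + τ) * δ / η ≤ 10 * ρ * η := by
      rw [mul_div_assoc]
      exact mul_le_mul (by linarith) hδη hδη0 (by positivity)
    have e3 : η * (ρ ^ 2 + τ ^ 2) ≤ η * (17 * ρ ^ 2) :=
      mul_le_mul_of_nonneg_left (by linarith) hη0.le
    have e4 : lam / 2 * (η * (ρ ^ 2 + τ ^ 2) + 2 * (ρ + τ) * δ / η)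
        ≤ lam / 2 * (η * (17 * ρ ^ 2) + 10 * ρ * η) :=
      mul_le_mul_of_nonneg_left (add_le_add e3 e2) (by positivity)
    have e5 : 0 ≤ η * (lam * (17 * ρ ^ 2 + 10 * ρ) / 2 + 5 * ρ + 1) := by positivity
    rw [← hηC, hC]
    linarith
  · rw [← channelFE_simple_scalar]
    refine (h2 γ hγ).trans ?_
    rw [div_mul_eq_mul_div, mul_div_assoc]
    refine mul_le_mul_of_nonneg_left ?_ hγ
    have e3 : η * (ρ + τ) ≤ η * (5 * ρ) := mul_le_mul_of_nonneg_left (by linarith) hη0.le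
    have e5 : 0 ≤ η * (lam * (17 * ρ ^ 2 + 10 * ρ) + 5 * ρ / 2 + 1 / 2) := by positivity
    rw [← hηC, hC]
    linarith

lemma channelFE_zero {ι : Type*} [Fintype ι] :
    channelFE P0 (fun _ (_ : ι) => (0 : ℝ)) = 0 := by
  simp [channelFE, channelPartition, channelEnergy]

lemma scalarFE_zero : scalarFE P0 0 = 0 := by
  simp [scalarFE]

lemma scalarFE_le (hmom : Integrable (fun x => x ^ 2) P0) {γ : ℝ} (hγ : 0 ≤ γ) :
    scalarFE P0 γ ≤ γ * ∫ x, x ^ 2 ∂P0 := by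
  have h := abs_scalar_channelFE_sub_le (T := fun _ => 0) measurable_const hmom (by simp)
    (by simpa using hmom) hγ one_pos
  simp only [mul_zero, channelFE_zero, sub_zero, ne_eq, OfNat.ofNat_ne_zero, not_false_eq_true,
    zero_pow, integral_zero, add_zero, one_mul, div_one] at h
  linarith [le_abs_self (scalarFE P0 γ)]

lemma RSpot_le_RSsup (hmom : Integrable (fun x => x ^ 2) P0) {lam : ℝ} (hlam : 0 ≤ lam) {q : ℝ}
    (hq : 0 ≤ q) : RSpot P0 lam q ≤ RSsup P0 lam := by
  refine le_csSup ⟨lam * (∫ x, x ^ 2 ∂P0) ^ 2, ?_⟩ ⟨q, hq, rfl⟩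
  rintro _ ⟨r, hr, rfl⟩
  have h := scalarFE_le hmom (mul_nonneg hlam hr)
  unfold RSpot
  nlinarith [mul_nonneg hlam (sq_nonneg (r / 2 - ∫ x, x ^ 2 ∂P0))]

/-- Asymptotic upper bound on the free energy. -/
lemma eventually_freeEnergy_lt (hmom : Integrable (fun x => x ^ 2) P0) {lam : ℝ} (hlam : 0 ≤ lam)
    {δ : ℝ} (hδ : 0 < δ) : ∀ᶠ n in atTop, freeEnergy P0 n lam < RSsup P0 lam + δ := by
  set ρ := ∫ x, x ^ 2 ∂P0 with hρ
  have hρ0 : 0 ≤ ρ := integral_nonneg fun _ => sq_nonneg _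
  set Q := 4 * (ρ + 1) with hQ
  have hQ0 : 0 ≤ Q := by positivity
  set h := lam * Q + lam / 2 + 1 with hh
  have hh0 : 0 < h := by positivity
  set ε := min 1 (δ / (2 * h)) with hεdef
  have hε : 0 < ε := by positivity
  have hε1 : ε ≤ 1 := min_le_left _ _
  have hεh : ε * h ≤ δ / 2 := by
    refine (mul_le_mul_of_nonneg_right (min_le_right _ _) hh0.le).trans (le_of_eq ?_)
    field_simp
  obtain ⟨T, hT1, hT2⟩ := exists_simpleFunc_approx hmom hlam hε
  have hprob := Measure.isProbabilityMeasure_map (μ := P0) (measurable_toRange T).aemeasurable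
  have h0 : 0 ≤ RSsup P0 lam := by
    refine le_trans (le_of_eq ?_) (RSpot_le_RSsup hmom hlam le_rfl)
    simp [RSpot, scalarFE_zero]
  have hB : ∀ q, 0 ≤ q → scalarGibbsFE (simpleWeight P0 T) Subtype.val (lam * q) - lam / 4 * q ^ 2
      ≤ RSsup P0 lam + ε * (lam * Q) := by
    intro q hq
    have hlq := mul_nonneg hlam hq
    have e1 := (abs_le.1 (hT2 (lam * q) hlq)).1
    rcases le_total q Q with hqQ | hqQ
    · have e2 := RSpot_le_RSsup hmom hlam hq
      have e3 := mul_le_mul_of_nonneg_left hqQ (mul_nonneg hε.le hlam)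
      unfold RSpot at e2
      linarith
    · have e2 := scalarFE_le hmom hlq
      rw [← hρ] at e2
      have e3 := mul_le_mul_of_nonneg_left hε1 hlq
      have e4 := mul_le_mul_of_nonneg_left hqQ hlq
      have e5 : 0 ≤ ε * (lam * Q) := by positivity
      rw [hQ] at e4
      linarith
  obtain ⟨C, hC0, hC⟩ := exists_wignerGibbsFE_le _ Subtype.val hlam hB hε
  have hlim : Tendsto (fun n : ℕ => C * (1 / (n : ℝ) + 1 / √(n : ℝ))) atTop (nhds 0) := by
    have e1 : Tendsto (fun n : ℕ => 1 / (n : ℝ)) atTop (nhds 0) :=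
      tendsto_one_div_atTop_nhds_zero_nat
    have e2 : Tendsto (fun n : ℕ => 1 / √(n : ℝ)) atTop (nhds 0) := by
      simp only [one_div]
      exact tendsto_inv_atTop_zero.comp
        (Real.tendsto_sqrt_atTop.comp tendsto_natCast_atTop_atTop)
    simpa using (e1.add e2).const_mul C
  filter_upwards [(tendsto_order.1 hlim).2 (δ / 2) (by positivity), eventually_gt_atTop 0]
    with n hn1 hn
  have hn' : (0 : ℝ) < n := by exact_mod_cast hn
  have e1 := (abs_le.1 (hT1 n hn)).2
  have e2 : 1 / n * wignerGibbsFE (simpleWeight P0 T) Subtype.val n lam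
      ≤ RSsup P0 lam + ε * (lam * Q) + lam * ε ^ 2 / 2 + C * (1 / (n : ℝ) + 1 / √(n : ℝ)) := by
    rw [one_div, inv_mul_le_iff₀ hn']
    refine (hC n hn).trans (le_of_eq ?_)
    have hs : (n : ℝ) * (1 / √(n : ℝ)) = √n := by
      rw [mul_one_div, Real.div_sqrt]
    have hs1 : (n : ℝ) * (1 / n) = 1 := mul_one_div_cancel hn'.ne'
    linear_combination (-C) * hs - C * hs1
  have e3 : lam * ε ^ 2 / 2 ≤ ε * (lam / 2) := by
    have := mul_le_mul_of_nonneg_left hε1 (mul_nonneg hlam hε.le)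
    linarith
  rw [hh] at hεh
  linarith

/-- Asymptotic lower bound on the free energy. -/
lemma eventually_lt_freeEnergy (hmom : Integrable (fun x => x ^ 2) P0) {lam : ℝ} (hlam : 0 ≤ lam)
    {q : ℝ} (hq : 0 ≤ q) {a : ℝ} (ha : a < RSpot P0 lam q) :
    ∀ᶠ n in atTop, a < freeEnergy P0 n lam := by
  have hlq := mul_nonneg hlam hq
  set ε := (RSpot P0 lam q - a) / (2 * (lam * q + 1)) with hεdef
  have hε : 0 < ε := div_pos (by linarith) (by positivity)
  have hεh : ε * (lam * q + 1) = (RSpot P0 lam q - a) / 2 := by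
    rw [hεdef]; field_simp
  obtain ⟨T, hT1, hT2⟩ := exists_simpleFunc_approx hmom hlam hε
  obtain ⟨K, hK, hv⟩ := exists_bound_of_fintype (fun k : T.range => (k : ℝ))
  have hlim : Tendsto (fun n : ℕ => lam * K ^ 4 / 4 * (1 / (n : ℝ))) atTop (nhds 0) := by
    have h := (tendsto_one_div_atTop_nhds_zero_nat (𝕜 := ℝ)).const_mul (lam * K ^ 4 / 4)
    rwa [mul_zero] at h
  filter_upwards [(tendsto_order.1 hlim).2 ((RSpot P0 lam q - a) / 2) (by linarith),
    eventually_gt_atTop 0] with n hn1 hn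
  have hn' : (0 : ℝ) < n := by exact_mod_cast hn
  have e1 := (abs_le.1 (hT1 n hn)).1
  have e2 := (abs_le.1 (hT2 (lam * q) hlq)).2
  have e3 : scalarGibbsFE (simpleWeight P0 T) Subtype.val (lam * q) - lam / 4 * q ^ 2
      ≤ 1 / n * wignerGibbsFE (simpleWeight P0 T) Subtype.val n lam
        + lam * K ^ 4 / 4 * (1 / (n : ℝ)) := by
    have h := le_wignerGibbsFE (simpleWeight_nonneg (P0 := P0) T) (sum_simpleWeight T) hv hlam hq hn
    rw [mul_comm, ← le_div_iff₀ hn'] at h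
    refine h.trans (le_of_eq ?_)
    ring
  unfold RSpot at *
  linarith

end Approximation

/-- **Replica-Symmetric formula for the spiked Wigner model.** -/
theorem rs_formula (P0 : Measure ℝ) [IsProbabilityMeasure P0]
    (hmom : Integrable (fun x => x ^ 2) P0) (lam : ℝ) (hlam : 0 < lam) :
    Tendsto (fun n => freeEnergy P0 n lam) atTop (nhds (RSsup P0 lam)) := by
  refine tendsto_order.2 ⟨fun a ha => ?_, fun a ha => ?_⟩
  · obtain ⟨_, ⟨q, hq, rfl⟩, hlt⟩ :=
      exists_lt_of_lt_csSup (Set.Nonempty.image _ ⟨0, Set.mem_Ici.2 le_rfl⟩) ha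
    exact eventually_lt_freeEnergy hmom hlam.le hq hlt
  · have h := eventually_freeEnergy_lt hmom hlam.le (sub_pos.2 ha)
    rwa [add_sub_cancel] at h

end
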